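/- arXiv:1310.6603 — 3 statements merged into one kernel-verified Lean document; each statement's English description precedes it below -/
import Mathlib

section
/- Quantum lower bound on disturbance (Eq. (4)). Let d ≥ 1 and let {ψ^x}_{x ∈ Fin d} and {φ^z}_{z ∈ Fin d} be two orthonormal bases of ℂ^d. Let a quantum instrument be given by Kraus operators K(m,j). Define p_N(m,x) := (1/d) ∑_{j∈J} ‖K(m,j) ψ^x‖², and define the classical–quantum state ω on ℂ^d ⊗ ℂ^{d'} ⊗ ℂ^{|M|}: ω := (1/d) ∑_{z∈Fin d} |z⟩⟨z| ⊗ ρ^z, where ρ^z := ∑_{m∈M} ∑_{j∈J} (K(m,j) φ^z)(K(m,j) φ^z)ᴴ ⊗ |m⟩⟨m| (with {|z⟩} and {|m⟩} standard basis flags), and let ω_{S'M} := (1/d) ∑_{z∈Fin d} ρ^z be its reduction. Then H(X|M) + [S(ω) − S(ω_{S'M})] ≥ −log₂ c, where H(X|M) is the conditional entropy computed from p_N, S denotes von Neumann entropy (base 2), and c := max_{x,z} |⟨ψ^x, φ^z⟩|². -/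
open scoped BigOperators Matrix

/-- Shannon entropy (base 2) of a distribution on a finite type. -/
noncomputable def entropy2 {α : Type*} [Fintype α] (p : α → ℝ) : ℝ :=
  ∑ a, -(p a * Real.logb 2 (p a))

/-- Conditional entropy `H(A|B)` (base 2) of a joint distribution `p : B × A → ℝ`,
conditioning on the first coordinate. -/
noncomputable def condEntropy2 {β α : Type*} [Fintype β] [Fintype α]
    (p : β × α → ℝ) : ℝ :=
  entropy2 p - entropy2 (fun b => ∑ a, p (b, a))

/-- Hermitian inner product on `Fin n → ℂ`, antilinear in the first argument. -/
noncomputable def dotc {n : ℕ} (u v : Fin n → ℂ) : ℂ :=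
  ∑ i, (starRingEnd ℂ) (u i) * v i

/-- Von Neumann entropy (base 2) of a Hermitian matrix, via its eigenvalues. -/
noncomputable def vnEntropy2 {n : Type*} [Fintype n] [DecidableEq n]
    {ρ : Matrix n n ℂ} (hρ : ρ.IsHermitian) : ℝ :=
  ∑ i, -(hρ.eigenvalues i * Real.logb 2 (hρ.eigenvalues i))

/-- The classical–quantum state `ω = (1/d) ∑_z |z⟩⟨z| ⊗ ρ^z` on `ℂ^d ⊗ ℂ^{d'} ⊗ ℂ^{|M|}`,
where `ρ^z = ∑_{m,j} (K(m,j) φ^z)(K(m,j) φ^z)ᴴ ⊗ |m⟩⟨m|`. -/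
noncomputable def cqState {d d' : ℕ} {M J : Type*} [Fintype M] [Fintype J] [DecidableEq M]
    (φ : Fin d → (Fin d → ℂ)) (K : M → J → Matrix (Fin d') (Fin d) ℂ) :
    Matrix (Fin d × Fin d' × M) (Fin d × Fin d' × M) ℂ :=
  Matrix.of fun p q =>
    if p.1 = q.1 ∧ p.2.2 = q.2.2 then
      (d : ℂ)⁻¹ * ∑ j, ((K p.2.2 j).mulVec (φ p.1) p.2.1)
        * (starRingEnd ℂ) ((K p.2.2 j).mulVec (φ p.1) q.2.1)
    else 0

/-- The reduction `ω_{S'M} = (1/d) ∑_z ρ^z` of the classical–quantum state `cqState`. -/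
noncomputable def cqStateReduced {d d' : ℕ} {M J : Type*} [Fintype M] [Fintype J] [DecidableEq M]
    (φ : Fin d → (Fin d → ℂ)) (K : M → J → Matrix (Fin d') (Fin d) ℂ) :
    Matrix (Fin d' × M) (Fin d' × M) ℂ :=
  Matrix.of fun p q =>
    if p.2 = q.2 then
      (d : ℂ)⁻¹ * ∑ z, ∑ j, ((K p.2 j).mulVec (φ z) p.1)
        * (starRingEnd ℂ) ((K p.2 j).mulVec (φ z) q.1)
    else 0

open Filter Topology in
lemma tendsto_mul_log_affine_sub {α r s : ℝ} (h : α ≠ 0 → 0 < s ∧ 0 < r) :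
    Tendsto (fun T => α * (Real.log (s + T * r) - Real.log s) - α * Real.log T) atTop
      (𝓝 (α * (Real.log r - Real.log s))) := by
  rcases eq_or_ne α 0 with rfl | hα
  · simp
  obtain ⟨hs, hr⟩ := h hα
  have h1 : Tendsto (fun T : ℝ => α * (Real.log (s / T + r) - Real.log s)) atTop
      (𝓝 (α * (Real.log (0 + r) - Real.log s))) := by
    refine Tendsto.const_mul _ (Tendsto.sub_const ?_ _)
    refine Tendsto.log ?_ (by simpa using hr.ne')
    exact (tendsto_const_nhds.div_atTop tendsto_id).add_const r
  rw [zero_add] at h1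
  refine h1.congr' ?_
  filter_upwards [eventually_gt_atTop 0] with T hT
  have : s + T * r = T * (s / T + r) := by field_simp
  rw [this, Real.log_mul hT.ne' (by positivity)]
  ring

lemma hasDerivAt_mul_log_affine {α r s T : ℝ} (h : α ≠ 0 → 0 < s ∧ 0 < r) (hT : 0 ≤ T) :
    HasDerivAt (fun T => α * (Real.log (s + T * r) - Real.log s)) (α * r / (s + T * r)) T := by
  rcases eq_or_ne α 0 with rfl | hα
  · simpa using hasDerivAt_const T (0 : ℝ)
  obtain ⟨hs, hr⟩ := h hα
  have h1 : HasDerivAt (fun T => s + T * r) r T := by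
    simpa using ((hasDerivAt_id T).mul_const r).const_add s
  have h2 := ((h1.log (by positivity)).sub_const (Real.log s)).const_mul α
  simpa [mul_div_assoc] using h2

open Filter Topology in
/-- Comparison of relative entropies obtained by integrating
`u ↦ ∑ α r / (s + u r)` over `u ∈ (0, ∞)`. -/
lemma sum_mul_log_sub_log_le {ι κ : Type*} [Fintype ι] [Fintype κ]
    (α r s : ι → ℝ) (p q : κ → ℝ)
    (h : ∀ i, α i ≠ 0 → 0 < s i ∧ 0 < r i) (hpq : ∀ x, p x ≠ 0 → 0 < q x ∧ 0 < p x)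
    (hsum : ∑ x, p x = ∑ i, α i)
    (hle : ∀ u : ℝ, 0 < u → ∑ x, p x * p x / (q x + u * p x) ≤
      ∑ i, α i * r i / (s i + u * r i)) :
    ∑ x, p x * (Real.log (p x) - Real.log (q x)) ≤
      ∑ i, α i * (Real.log (r i) - Real.log (s i)) := by
  set g : ℝ → ℝ := fun T => ∑ i, α i * (Real.log (s i + T * r i) - Real.log (s i)) -
    ∑ x, p x * (Real.log (q x + T * p x) - Real.log (q x)) with hg
  have hderiv : ∀ T : ℝ, 0 ≤ T → HasDerivAt g (∑ i, α i * r i / (s i + T * r i) -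
      ∑ x, p x * p x / (q x + T * p x)) T := fun T hT =>
    (HasDerivAt.fun_sum fun i _ => hasDerivAt_mul_log_affine (h i) hT).sub
      (HasDerivAt.fun_sum fun x _ => hasDerivAt_mul_log_affine (hpq x) hT)
  have hmono : MonotoneOn g (Set.Ici 0) := by
    refine monotoneOn_of_deriv_nonneg (convex_Ici 0)
      (fun T hT => (hderiv T hT).continuousAt.continuousWithinAt) ?_ ?_
    · intro T hT
      rw [interior_Ici] at hT
      exact (hderiv T (le_of_lt hT)).differentiableAt.differentiableWithinAt
    · intro T hT
      rw [interior_Ici] at hT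
      rw [(hderiv T (le_of_lt hT)).deriv]
      exact sub_nonneg.2 (hle T hT)
  have hg0 : g 0 = 0 := by simp [hg]
  have hlim : Tendsto g atTop (𝓝 (∑ i, α i * (Real.log (r i) - Real.log (s i)) -
      ∑ x, p x * (Real.log (p x) - Real.log (q x)))) := by
    refine ((tendsto_finsetSum _ fun i _ => tendsto_mul_log_affine_sub (h i)).sub
      (tendsto_finsetSum _ fun x _ => tendsto_mul_log_affine_sub (hpq x))).congr fun T => ?_
    rw [Finset.sum_sub_distrib, Finset.sum_sub_distrib, ← Finset.sum_mul, ← Finset.sum_mul, hsum]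
    ring
  refine sub_nonneg.1 (ge_of_tendsto hlim ?_)
  filter_upwards [eventually_ge_atTop 0] with T hT
  rw [← hg0]
  exact hmono Set.self_mem_Ici hT hT

section SpectralForms

variable {n : Type*} [Fintype n] [DecidableEq n]

lemma mul_diagonal_mul_conjTranspose_apply_self {m : Type*} (A : Matrix m n ℂ) (r : n → ℝ)
    (i : m) :
    (A * Matrix.diagonal (fun k => (r k : ℂ)) * Aᴴ) i i =
      ((∑ k, Complex.normSq (A i k) * r k : ℝ) : ℂ) := by
  rw [Matrix.mul_apply]
  push_cast
  refine Finset.sum_congr rfl fun k _ => ?_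
  rw [Matrix.mul_diagonal, Matrix.conjTranspose_apply, Complex.normSq_eq_conj_mul_self]
  simp only [starRingEnd_apply]
  ring

lemma sum_normSq_row_eq_one {U : Matrix n n ℂ} (hU : U * Uᴴ = 1) (l : n) :
    ∑ k, Complex.normSq (U l k) = 1 := by
  have h := mul_diagonal_mul_conjTranspose_apply_self U (fun _ => 1) l
  simp only [Complex.ofReal_one, Matrix.diagonal_one, hU, Matrix.one_apply_eq,
    mul_one] at h
  exact_mod_cast h.symm

lemma sum_normSq_col_eq_one {U : Matrix n n ℂ} (hU : U * Uᴴ = 1) (k : n) :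
    ∑ l, Complex.normSq (U l k) = 1 := by
  have h := sum_normSq_row_eq_one (U := Uᴴ)
    (by rw [Matrix.conjTranspose_conjTranspose]; exact mul_eq_one_comm.1 hU) k
  simpa [Matrix.conjTranspose_apply, ← starRingEnd_apply, Complex.normSq_conj] using h

lemma two_mul_re_mul_le {r s u : ℝ} (hr : 0 ≤ r) (hs : 0 ≤ s) (hu : 0 < u) (b w : ℂ) :
    2 * (r * (b * (starRingEnd ℂ) w).re) ≤
      Complex.normSq w * r * r / (s + u * r) + Complex.normSq b * (s + u * r) := by
  rcases hr.eq_or_lt with rfl | hr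
  · simpa using mul_nonneg (Complex.normSq_nonneg b) hs
  have ht : 0 < s + u * r := by positivity
  set t := s + u * r
  have key : Complex.normSq w * r * r / t + Complex.normSq b * t -
      2 * (r * (b * (starRingEnd ℂ) w).re) =
      ((r * w.re - t * b.re) ^ 2 + (r * w.im - t * b.im) ^ 2) / t := by
    simp only [Complex.normSq_apply, Complex.mul_re, Complex.conj_re, Complex.conj_im]
    field_simp
    ring
  have : 0 ≤ ((r * w.re - t * b.re) ^ 2 + (r * w.im - t * b.im) ^ 2) / t := by positivity
  linarith

/-- Variational lower bound on the quadratic relative quasi-entropies of two positive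
semidefinite matrices, given by their spectral decompositions, in terms of their diagonals. -/
lemma two_mul_sum_diag_le (U V ρ σ : Matrix n n ℂ) (r s : n → ℝ)
    (hU : U * Uᴴ = 1) (hV : V * Vᴴ = 1)
    (hρ : ρ = U * Matrix.diagonal (fun k => (r k : ℂ)) * Uᴴ)
    (hσ : σ = V * Matrix.diagonal (fun k => (s k : ℂ)) * Vᴴ)
    (hr : ∀ k, 0 ≤ r k) (hs : ∀ l, 0 ≤ s l) (a : n → ℝ) {u : ℝ} (hu : 0 < u) :
    2 * ∑ i, a i * (ρ i i).re ≤
      ∑ l, ∑ k, Complex.normSq ((Vᴴ * U) l k) * r k * r k / (s l + u * r k) +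
        ∑ i, a i ^ 2 * ((σ i i).re + u * (ρ i i).re) := by
  set D : Matrix n n ℂ := Matrix.diagonal fun i => (a i : ℂ) with hD
  set B : Matrix n n ℂ := Vᴴ * D * U with hB
  have hDH : Dᴴ = D := by
    rw [hD, Matrix.diagonal_conjTranspose]; congr 1; ext i; simp
  have hDD : D * D = Matrix.diagonal fun i => ((a i ^ 2 : ℝ) : ℂ) := by
    rw [hD, Matrix.diagonal_mul_diagonal]; congr 1; ext i; push_cast; ring
  have hBrow : ∀ l, ∑ k, Complex.normSq (B l k) = ∑ i, Complex.normSq (V i l) * a i ^ 2 := by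
    intro l
    have h1 := mul_diagonal_mul_conjTranspose_apply_self B (fun _ => 1) l
    have h2 := mul_diagonal_mul_conjTranspose_apply_self Vᴴ (fun i => a i ^ 2) l
    rw [← hDD] at h2
    have h3 : B * Bᴴ = Vᴴ * (D * D) * Vᴴᴴ := by
      rw [hB, Matrix.conjTranspose_mul, Matrix.conjTranspose_mul, hDH]
      calc Vᴴ * D * U * (Uᴴ * (D * Vᴴᴴ)) = Vᴴ * D * (U * Uᴴ) * (D * Vᴴᴴ) := by
            simp only [Matrix.mul_assoc]
        _ = _ := by rw [hU, Matrix.mul_one]; simp only [Matrix.mul_assoc]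
    simp only [Complex.ofReal_one, Matrix.diagonal_one, mul_one] at h1
    rw [h3, h2] at h1
    have h4 := Complex.ofReal_injective h1
    rw [← h4]
    simp [Matrix.conjTranspose_apply, ← starRingEnd_apply, Complex.normSq_conj]
  have hBcol : ∀ k, ∑ l, Complex.normSq (B l k) = ∑ i, Complex.normSq (U i k) * a i ^ 2 := by
    intro k
    have h1 := mul_diagonal_mul_conjTranspose_apply_self Bᴴ (fun _ => 1) k
    have h2 := mul_diagonal_mul_conjTranspose_apply_self Uᴴ (fun i => a i ^ 2) k
    rw [← hDD] at h2
    have h3 : Bᴴ * Bᴴᴴ = Uᴴ * (D * D) * Uᴴᴴ := by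
      simp only [hB, Matrix.conjTranspose_mul, Matrix.conjTranspose_conjTranspose, hDH]
      calc Uᴴ * (D * V) * (Vᴴ * D * U) = Uᴴ * D * (V * Vᴴ) * (D * U) := by
            simp only [Matrix.mul_assoc]
        _ = _ := by rw [hV, Matrix.mul_one]; simp only [Matrix.mul_assoc]
    simp only [Complex.ofReal_one, Matrix.diagonal_one, mul_one] at h1
    rw [h3, h2] at h1
    have h4 := Complex.ofReal_injective h1
    simp only [Matrix.conjTranspose_apply, ← starRingEnd_apply, Complex.normSq_conj] at h4
    exact h4.symm
  have hρd : ∀ i, (ρ i i).re = ∑ k, Complex.normSq (U i k) * r k := fun i => by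
    rw [hρ, mul_diagonal_mul_conjTranspose_apply_self, Complex.ofReal_re]
  have hσd : ∀ i, (σ i i).re = ∑ k, Complex.normSq (V i k) * s k := fun i => by
    rw [hσ, mul_diagonal_mul_conjTranspose_apply_self, Complex.ofReal_re]
  have hquad : ∑ i, a i ^ 2 * ((σ i i).re + u * (ρ i i).re) =
      ∑ l, ∑ k, Complex.normSq (B l k) * (s l + u * r k) := by
    have e1 : ∑ l, ∑ k, Complex.normSq (B l k) * s l = ∑ i, a i ^ 2 * (σ i i).re := by
      simp_rw [← Finset.sum_mul, hBrow, hσd, Finset.sum_mul, Finset.mul_sum]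
      rw [Finset.sum_comm]
      exact Finset.sum_congr rfl fun i _ => Finset.sum_congr rfl fun l _ => by ring
    have e2 : ∑ l, ∑ k, Complex.normSq (B l k) * (u * r k) =
        ∑ i, a i ^ 2 * (u * (ρ i i).re) := by
      rw [Finset.sum_comm]
      simp_rw [← Finset.sum_mul, hBcol, hρd, Finset.sum_mul, Finset.mul_sum]
      rw [Finset.sum_comm]
      exact Finset.sum_congr rfl fun i _ => Finset.sum_congr rfl fun l _ => by ring
    simp_rw [mul_add, Finset.sum_add_distrib, e1, e2]
  have hlin : ∑ i, a i * (ρ i i).re =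
      ∑ l, ∑ k, r k * (B l k * (starRingEnd ℂ) ((Vᴴ * U) l k)).re := by
    have e1 : (∑ i, (a i : ℂ) * ρ i i) =
        ∑ l, ∑ k, (r k : ℂ) * (B l k * (starRingEnd ℂ) ((Vᴴ * U) l k)) := by
      calc (∑ i, (a i : ℂ) * ρ i i) = (D * ρ).trace := by
            simp [Matrix.trace, hD, Matrix.diagonal_mul]
        _ = (V * (Vᴴ * (D * ρ))).trace := by
            rw [← Matrix.mul_assoc V, hV, Matrix.one_mul]
        _ = (B * Matrix.diagonal (fun k => (r k : ℂ)) * (Vᴴ * U)ᴴ).trace := by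
            rw [Matrix.trace_mul_comm, hρ, hB, Matrix.conjTranspose_mul,
              Matrix.conjTranspose_conjTranspose]
            simp only [Matrix.mul_assoc]
        _ = _ := by
            simp only [Matrix.trace, Matrix.diag]
            refine Finset.sum_congr rfl fun l _ => ?_
            rw [Matrix.mul_apply]
            refine Finset.sum_congr rfl fun k _ => ?_
            rw [Matrix.mul_diagonal, Matrix.conjTranspose_apply, starRingEnd_apply]
            ring
    have e2 := congrArg Complex.re e1
    simpa only [Complex.re_sum, Complex.re_ofReal_mul] using e2
  rw [hlin, hquad, Finset.mul_sum, ← Finset.sum_add_distrib]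
  refine Finset.sum_le_sum fun l _ => ?_
  rw [Finset.mul_sum, ← Finset.sum_add_distrib]
  exact Finset.sum_le_sum fun k _ => two_mul_re_mul_le (hr k) (hs l) hu _ _

/-- Monotonicity of the quantum relative entropy under a (coarse-grained) projective measurement
in the standard basis, for matrices given by spectral decompositions. -/
lemma measured_relative_entropy_le {κ : Type*} [Fintype κ] [DecidableEq κ]
    (U V ρ σ : Matrix n n ℂ) (r s : n → ℝ)
    (hU : U * Uᴴ = 1) (hV : V * Vᴴ = 1)
    (hρ : ρ = U * Matrix.diagonal (fun k => (r k : ℂ)) * Uᴴ)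
    (hσ : σ = V * Matrix.diagonal (fun k => (s k : ℂ)) * Vᴴ)
    (hr : ∀ k, 0 ≤ r k) (hs : ∀ l, 0 ≤ s l)
    (hker : ∀ l, s l = 0 → ((Vᴴ * ρ * V) l l).re = 0)
    (π : n → κ) (p q : κ → ℝ) (hp : ∀ x, p x = ∑ i with π i = x, (ρ i i).re)
    (hq : ∀ x, ∑ i with π i = x, (σ i i).re ≤ q x) (hpq : ∀ x, p x ≠ 0 → 0 < q x) :
    ∑ x, p x * (Real.log (p x) - Real.log (q x)) ≤
      ∑ k, r k * Real.log (r k) - ∑ l, ((Vᴴ * ρ * V) l l).re * Real.log (s l) := by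
  set w : n → n → ℝ := fun l k => Complex.normSq ((Vᴴ * U) l k) with hw
  have hw0 : ∀ l k, 0 ≤ w l k := fun l k => Complex.normSq_nonneg _
  have hVU : (Vᴴ * U) * (Vᴴ * U)ᴴ = 1 := by
    rw [Matrix.conjTranspose_mul, Matrix.conjTranspose_conjTranspose]
    calc Vᴴ * U * (Uᴴ * V) = Vᴴ * (U * Uᴴ) * V := by simp only [Matrix.mul_assoc]
      _ = 1 := by rw [hU, Matrix.mul_one]; exact mul_eq_one_comm.1 hV
  have hdiag : ∀ l, ((Vᴴ * ρ * V) l l).re = ∑ k, w l k * r k := by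
    intro l
    have : Vᴴ * ρ * V = (Vᴴ * U) * Matrix.diagonal (fun k => (r k : ℂ)) * (Vᴴ * U)ᴴ := by
      rw [hρ, Matrix.conjTranspose_mul, Matrix.conjTranspose_conjTranspose]
      simp only [Matrix.mul_assoc]
    rw [this, mul_diagonal_mul_conjTranspose_apply_self, Complex.ofReal_re]
  have hρd : ∀ i, (ρ i i).re = ∑ k, Complex.normSq (U i k) * r k := fun i => by
    rw [hρ, mul_diagonal_mul_conjTranspose_apply_self, Complex.ofReal_re]
  have hσd : ∀ i, (σ i i).re = ∑ k, Complex.normSq (V i k) * s k := fun i => by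
    rw [hσ, mul_diagonal_mul_conjTranspose_apply_self, Complex.ofReal_re]
  have hp0 : ∀ x, 0 ≤ p x := fun x => by
    rw [hp]
    refine Finset.sum_nonneg fun i _ => ?_
    rw [hρd]
    exact Finset.sum_nonneg fun k _ => mul_nonneg (Complex.normSq_nonneg _) (hr k)
  have hq0 : ∀ x, 0 ≤ q x := fun x => by
    refine le_trans (Finset.sum_nonneg fun i _ => ?_) (hq x)
    rw [hσd]
    exact Finset.sum_nonneg fun k _ => mul_nonneg (Complex.normSq_nonneg _) (hs k)
  have hcol : ∀ k, ∑ l, w l k = 1 := sum_normSq_col_eq_one hVU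
  have main := sum_mul_log_sub_log_le (ι := n × n)
    (fun lk => w lk.1 lk.2 * r lk.2) (fun lk => r lk.2) (fun lk => s lk.1) p q
    (fun lk hne => ?_) (fun x hx => ⟨hpq x hx, lt_of_le_of_ne (hp0 x) hx.symm⟩) ?_ ?_
  · refine main.trans (le_of_eq ?_)
    rw [Fintype.sum_prod_type]
    simp_rw [mul_sub, Finset.sum_sub_distrib, hdiag, Finset.sum_mul]
    congr 1
    rw [Finset.sum_comm]
    refine Finset.sum_congr rfl fun k _ => ?_
    simp_rw [mul_assoc, ← Finset.sum_mul, hcol, one_mul]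
  · refine ⟨lt_of_le_of_ne (hs _) fun h0 => hne ?_,
      lt_of_le_of_ne (hr _) fun h0 => hne (by simp [← h0])⟩
    have h1 := hker lk.1 h0.symm
    rw [hdiag] at h1
    exact (Finset.sum_eq_zero_iff_of_nonneg fun k _ => mul_nonneg (hw0 _ k) (hr k)).1 h1 lk.2
      (Finset.mem_univ _)
  · rw [Fintype.sum_prod_type, Finset.sum_comm]
    simp_rw [← Finset.sum_mul, hcol, one_mul, hp]
    rw [Finset.sum_fiberwise]
    simp_rw [hρd]
    rw [Finset.sum_comm]
    simp_rw [← Finset.sum_mul, sum_normSq_col_eq_one hU, one_mul]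
  · intro u hu
    have hv := two_mul_sum_diag_le U V ρ σ r s hU hV hρ hσ hr hs
      (fun i => p (π i) / (q (π i) + u * p (π i))) hu
    have e1 : ∑ i, p (π i) / (q (π i) + u * p (π i)) * (ρ i i).re =
        ∑ x, p x * p x / (q x + u * p x) := by
      rw [← Finset.sum_fiberwise _ π]
      refine Finset.sum_congr rfl fun x _ => ?_
      rw [Finset.sum_congr rfl (g := fun i => p x / (q x + u * p x) * (ρ i i).re)
        (fun i hi => by rw [(Finset.mem_filter.1 hi).2]), ← Finset.mul_sum, ← hp]
      ring
    have e2 : ∑ i, (p (π i) / (q (π i) + u * p (π i))) ^ 2 * ((σ i i).re + u * (ρ i i).re) ≤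
        ∑ x, p x * p x / (q x + u * p x) := by
      rw [← Finset.sum_fiberwise _ π]
      refine Finset.sum_le_sum fun x _ => ?_
      rw [Finset.sum_congr rfl
        (g := fun i => (p x / (q x + u * p x)) ^ 2 * ((σ i i).re + u * (ρ i i).re))
        (fun i hi => by rw [(Finset.mem_filter.1 hi).2]), ← Finset.mul_sum,
        Finset.sum_add_distrib, ← Finset.mul_sum, ← hp]
      refine (mul_le_mul_of_nonneg_left (add_le_add_left (hq x) _) (sq_nonneg _)).trans
        (le_of_eq ?_)
      rcases eq_or_ne (q x + u * p x) 0 with h0 | h0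
      · simp [h0]
      · field_simp
    rw [Fintype.sum_prod_type]
    rw [e1] at hv
    linarith

/-- The diagonal of a matrix and of its dephasing agree in any eigenbasis of the dephasing,
up to summation against a function of the eigenvalue. -/
lemma sum_diag_mul_of_dephasing {ζ : Type*} [DecidableEq ζ] (z : n → ζ)
    (V ρ σ : Matrix n n ℂ) (s : n → ℝ) (hV : V * Vᴴ = 1)
    (hσ : σ = V * Matrix.diagonal (fun k => (s k : ℂ)) * Vᴴ)
    (hρσ : ∀ a b, σ a b = if z a = z b then ρ a b else 0) (f : ℝ → ℝ) :
    ∑ l, ((Vᴴ * ρ * V) l l).re * f (s l) = ∑ l, s l * f (s l) := by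
  have hV' : Vᴴ * V = 1 := mul_eq_one_comm.1 hV
  set F : Matrix n n ℂ := Matrix.diagonal fun l => (f (s l) : ℂ) with hF
  set L : Matrix n n ℂ := V * F * Vᴴ with hL
  have hLz : ∀ a b, z a ≠ z b → L a b = 0 := by
    intro a b hab
    set D : Matrix n n ℂ := Matrix.diagonal fun i => if z i = z a then 1 else 0 with hD
    have hDσ : D * σ = σ * D := by
      ext i j
      rw [hD, Matrix.diagonal_mul, Matrix.mul_diagonal, hρσ]
      by_cases hij : z i = z j
      · simp [hij, mul_comm]
      · simp [hij]
    have hcomm : (Vᴴ * D * V) * Matrix.diagonal (fun k => (s k : ℂ)) =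
        Matrix.diagonal (fun k => (s k : ℂ)) * (Vᴴ * D * V) := by
      calc (Vᴴ * D * V) * Matrix.diagonal (fun k => (s k : ℂ))
          = Vᴴ * (D * σ) * V := by
            rw [hσ]; simp only [Matrix.mul_assoc, hV', Matrix.mul_one]
        _ = Vᴴ * (σ * D) * V := by rw [hDσ]
        _ = (Vᴴ * V) * Matrix.diagonal (fun k => (s k : ℂ)) * (Vᴴ * D * V) := by
            rw [hσ]; simp only [Matrix.mul_assoc]
        _ = _ := by rw [hV', Matrix.one_mul]
    have hcommF : (Vᴴ * D * V) * F = F * (Vᴴ * D * V) := by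
      ext i j
      have hij := congrFun (congrFun hcomm i) j
      rw [Matrix.diagonal_mul, Matrix.mul_diagonal] at hij
      rw [hF, Matrix.diagonal_mul, Matrix.mul_diagonal]
      by_cases h : s i = s j
      · rw [h, mul_comm]
      · have : (Vᴴ * D * V) i j = 0 := by
          have h2 : ((s i : ℂ) - s j) * (Vᴴ * D * V) i j = 0 := by linear_combination -hij
          refine (mul_eq_zero.1 h2).resolve_left fun h3 => h ?_
          exact_mod_cast sub_eq_zero.1 h3
        simp [this]
    have hDL : D * L = L * D := by
      calc D * L = (V * Vᴴ) * (D * L) := by rw [hV, Matrix.one_mul]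
        _ = V * ((Vᴴ * D * V) * F) * Vᴴ := by rw [hL]; simp only [Matrix.mul_assoc]
        _ = L * D * (V * Vᴴ) := by rw [hcommF, hL]; simp only [Matrix.mul_assoc]
        _ = L * D := by rw [hV, Matrix.mul_one]
    have h := congrFun (congrFun hDL a) b
    rw [hD, Matrix.diagonal_mul, Matrix.mul_diagonal] at h
    simpa [hab.symm] using h
  have htr : (ρ * L).trace = (σ * L).trace := by
    simp only [Matrix.trace, Matrix.diag, Matrix.mul_apply]
    refine Finset.sum_congr rfl fun a _ => Finset.sum_congr rfl fun b _ => ?_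
    rw [hρσ]
    by_cases h : z a = z b
    · simp [h]
    · simp [h, hLz b a (Ne.symm h)]
  have hform : ∀ τ : Matrix n n ℂ, (τ * L).trace = ∑ l, (Vᴴ * τ * V) l l * f (s l) := by
    intro τ
    rw [hL, ← Matrix.mul_assoc, Matrix.trace_mul_comm, ← Matrix.mul_assoc, ← Matrix.mul_assoc, hF]
    simp [Matrix.trace, Matrix.mul_diagonal]
  have hσV : Vᴴ * σ * V = Matrix.diagonal fun k => (s k : ℂ) := by
    calc Vᴴ * σ * V = (Vᴴ * V) * Matrix.diagonal (fun k => (s k : ℂ)) * (Vᴴ * V) := by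
          rw [hσ]; simp only [Matrix.mul_assoc]
      _ = _ := by rw [hV', Matrix.one_mul, Matrix.mul_one]
  rw [hform, hform, hσV] at htr
  have h := congrArg Complex.re htr
  simpa using h

end SpectralForms

section Entropy

variable {m n : Type*} [Fintype m] [Fintype n] [DecidableEq m] [DecidableEq n]

lemma vnEntropy2_eq_roots {ρ : Matrix n n ℂ} (hρ : ρ.IsHermitian) :
    vnEntropy2 hρ =
      (ρ.charpoly.roots.map fun t : ℂ => -(t.re * Real.logb 2 t.re)).sum := by
  rw [hρ.roots_charpoly_eq_eigenvalues, Multiset.map_map]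
  rfl

open Polynomial in
/-- `A Aᴴ` and `Aᴴ A` have the same entropy. -/
lemma vnEntropy2_mul_conjTranspose_comm (A : Matrix m n ℂ) {ρ : Matrix m m ℂ}
    (hA : ρ = A * Aᴴ) (hρ : ρ.IsHermitian) (hσ : (Aᴴ * A).IsHermitian) :
    vnEntropy2 hρ = vnEntropy2 hσ := by
  rw [vnEntropy2_eq_roots, vnEntropy2_eq_roots, hA]
  have h := congrArg (fun P : ℂ[X] =>
      (P.roots.map fun t : ℂ => -(t.re * Real.logb 2 t.re)).sum)
    (Matrix.charpoly_mul_comm' A Aᴴ)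
  have hne : ∀ (k : ℕ) {P : ℂ[X]}, P.Monic → X ^ k * P ≠ 0 := fun k P hP =>
    ((monic_X_pow k).mul hP).ne_zero
  simp only [roots_mul (hne _ (Matrix.charpoly_monic _)), Multiset.map_add, Multiset.sum_add,
    roots_X_pow, Multiset.map_nsmul, Multiset.map_singleton, Multiset.sum_nsmul,
    Multiset.sum_singleton, Complex.zero_re, zero_mul, neg_zero, smul_zero, zero_add] at h
  exact h

lemma vnEntropy2_eq_log {ρ : Matrix n n ℂ} (hρ : ρ.IsHermitian) :
    vnEntropy2 hρ = -(∑ i, hρ.eigenvalues i * Real.log (hρ.eigenvalues i)) / Real.log 2 := by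
  simp only [vnEntropy2, Real.logb, neg_div, Finset.sum_div, ← Finset.sum_neg_distrib,
    mul_div_assoc]

lemma isHermitian_eq_mul_diagonal {ρ : Matrix n n ℂ} (hρ : ρ.IsHermitian) :
    ρ = (hρ.eigenvectorUnitary : Matrix n n ℂ) *
      Matrix.diagonal (fun k => (hρ.eigenvalues k : ℂ)) *
      (hρ.eigenvectorUnitary : Matrix n n ℂ)ᴴ := by
  conv_lhs => rw [hρ.spectral_theorem, Unitary.conjStarAlgAut_apply]
  rfl

lemma eigenvectorUnitary_mul_conjTranspose {ρ : Matrix n n ℂ} (hρ : ρ.IsHermitian) :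
    (hρ.eigenvectorUnitary : Matrix n n ℂ) * (hρ.eigenvectorUnitary : Matrix n n ℂ)ᴴ = 1 :=
  Matrix.mem_unitaryGroup_iff.1 hρ.eigenvectorUnitary.2

end Entropy

section OrthonormalBases

variable {d : ℕ}

/-- The matrix whose columns are the vectors `ψ x`. -/
def columnMatrix (ψ : Fin d → (Fin d → ℂ)) : Matrix (Fin d) (Fin d) ℂ :=
  Matrix.of fun k x => ψ x k

lemma columnMatrix_mul_conjTranspose {ψ : Fin d → (Fin d → ℂ)}
    (hψ : ∀ x x', dotc (ψ x) (ψ x') = if x = x' then 1 else 0) :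
    columnMatrix ψ * (columnMatrix ψ)ᴴ = 1 := by
  refine mul_eq_one_comm.1 ?_
  ext x x'
  rw [Matrix.one_apply, ← hψ, Matrix.mul_apply]
  rfl

lemma conjTranspose_columnMatrix_mul_apply (φ ψ : Fin d → (Fin d → ℂ)) (z x : Fin d) :
    ((columnMatrix φ)ᴴ * columnMatrix ψ) z x = dotc (φ z) (ψ x) := by
  rw [Matrix.mul_apply]
  rfl

lemma mul_columnMatrix_apply {m : Type*} (A : Matrix m (Fin d) ℂ) (ψ : Fin d → (Fin d → ℂ))
    (i : m) (x : Fin d) : (A * columnMatrix ψ) i x = A.mulVec (ψ x) i := by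
  rw [Matrix.mul_apply]
  rfl

lemma sum_normSq_mulVec {m : Type*} (A : Matrix m (Fin d) ℂ) {ψ : Fin d → (Fin d → ℂ)}
    (hψ : ∀ x x', dotc (ψ x) (ψ x') = if x = x' then 1 else 0) (i : m) :
    ∑ x, Complex.normSq (A.mulVec (ψ x) i) = ∑ k, Complex.normSq (A i k) := by
  have h1 := mul_diagonal_mul_conjTranspose_apply_self (A * columnMatrix ψ) (fun _ => 1) i
  have h2 := mul_diagonal_mul_conjTranspose_apply_self A (fun _ => 1) i
  simp only [Complex.ofReal_one, Matrix.diagonal_one, Matrix.mul_one, mul_one] at h1 h2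
  have h3 : A * columnMatrix ψ * (A * columnMatrix ψ)ᴴ = A * Aᴴ := by
    rw [Matrix.conjTranspose_mul]
    calc _ = A * (columnMatrix ψ * (columnMatrix ψ)ᴴ) * Aᴴ := by simp only [Matrix.mul_assoc]
      _ = _ := by rw [columnMatrix_mul_conjTranspose hψ, Matrix.mul_one]
  rw [h3, h2] at h1
  rw [Complex.ofReal_injective h1]
  exact Finset.sum_congr rfl fun x _ => by rw [mul_columnMatrix_apply]

lemma overlap_mul_conjTranspose {φ ψ : Fin d → (Fin d → ℂ)}
    (hφ : ∀ z z', dotc (φ z) (φ z') = if z = z' then 1 else 0)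
    (hψ : ∀ x x', dotc (ψ x) (ψ x') = if x = x' then 1 else 0) :
    ((columnMatrix φ)ᴴ * columnMatrix ψ) * ((columnMatrix φ)ᴴ * columnMatrix ψ)ᴴ = 1 := by
  rw [Matrix.conjTranspose_mul, Matrix.conjTranspose_conjTranspose]
  calc _ = (columnMatrix φ)ᴴ * (columnMatrix ψ * (columnMatrix ψ)ᴴ) * columnMatrix φ := by
        simp only [Matrix.mul_assoc]
    _ = 1 := by
        rw [columnMatrix_mul_conjTranspose hψ, Matrix.mul_one]
        exact mul_eq_one_comm.1 (columnMatrix_mul_conjTranspose hφ)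

lemma sum_dotc_mul_mulVec {m : Type*} (A : Matrix m (Fin d) ℂ) {φ : Fin d → (Fin d → ℂ)}
    (hφ : ∀ z z', dotc (φ z) (φ z') = if z = z' then 1 else 0) (ψ : Fin d → (Fin d → ℂ))
    (x : Fin d) (i : m) :
    ∑ z, A.mulVec (φ z) i * dotc (φ z) (ψ x) = A.mulVec (ψ x) i := by
  have h : (A * columnMatrix φ) * ((columnMatrix φ)ᴴ * columnMatrix ψ) = A * columnMatrix ψ := by
    calc _ = A * (columnMatrix φ * (columnMatrix φ)ᴴ) * columnMatrix ψ := by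
          simp only [Matrix.mul_assoc]
      _ = _ := by rw [columnMatrix_mul_conjTranspose hφ, Matrix.mul_one]
  have h' := congrFun (congrFun h i) x
  rw [Matrix.mul_apply, mul_columnMatrix_apply] at h'
  rw [← h']
  exact Finset.sum_congr rfl fun z _ => by
    rw [mul_columnMatrix_apply, conjTranspose_columnMatrix_mul_apply]

lemma normSq_dotc_comm (u v : Fin d → ℂ) :
    Complex.normSq (dotc u v) = Complex.normSq (dotc v u) := by
  rw [← Complex.normSq_conj, dotc, dotc, map_sum]
  congr 1
  exact Finset.sum_congr rfl fun i _ => by simp [mul_comm]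

end OrthonormalBases

section Instrument

variable {d d' : ℕ} {M J : Type*} [DecidableEq M]

/-- Square root of the joint state: its Gram matrices are the reduced output state and the
state of the complementary systems (reference, environment, outcome). -/
noncomputable def instrumentFactor (φ : Fin d → (Fin d → ℂ))
    (K : M → J → Matrix (Fin d') (Fin d) ℂ) :
    Matrix (Fin d' × M) (Fin d × J × M) ℂ :=
  Matrix.of fun a b =>
    if a.2 = b.2.2 then ((√(d : ℝ))⁻¹ : ℝ) * (K a.2 b.2.1).mulVec (φ b.1) a.1 else 0

/-- Square root of the joint state after copying the label `z`. -/
noncomputable def instrumentFactorCopy (φ : Fin d → (Fin d → ℂ))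
    (K : M → J → Matrix (Fin d') (Fin d) ℂ) :
    Matrix (Fin d × Fin d' × M) (Fin d × J × M) ℂ :=
  Matrix.of fun a b =>
    if a.1 = b.1 ∧ a.2.2 = b.2.2 then
      ((√(d : ℝ))⁻¹ : ℝ) * (K a.2.2 b.2.1).mulVec (φ b.1) a.2.1
    else 0

/-- Change of basis from `φ` to `ψ` on the reference system. -/
noncomputable def referenceBasisChange (φ ψ : Fin d → (Fin d → ℂ)) (M J : Type*)
    [DecidableEq M] [DecidableEq J] : Matrix (Fin d × J × M) (Fin d × J × M) ℂ :=
  Matrix.of fun a b => if a.2 = b.2 then dotc (φ a.1) (ψ b.1) else 0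

lemma ofReal_inv_sqrt_mul_self (d : ℕ) :
    (((√(d : ℝ))⁻¹ : ℝ) : ℂ) * (((√(d : ℝ))⁻¹ : ℝ) : ℂ) = (d : ℂ)⁻¹ := by
  rw [← Complex.ofReal_mul, ← mul_inv, Real.mul_self_sqrt (Nat.cast_nonneg d)]
  simp

variable [Fintype M]

lemma instrumentFactorCopy_gram_apply (φ : Fin d → (Fin d → ℂ))
    (K : M → J → Matrix (Fin d') (Fin d) ℂ) (a b : Fin d × J × M) :
    ((instrumentFactorCopy φ K)ᴴ * instrumentFactorCopy φ K) a b =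
      if a.1 = b.1 then ((instrumentFactor φ K)ᴴ * instrumentFactor φ K) a b else 0 := by
  rw [Matrix.mul_apply, Matrix.mul_apply, Fintype.sum_prod_type]
  simp only [instrumentFactorCopy, instrumentFactor, Matrix.of_apply, Matrix.conjTranspose_apply]
  rw [Finset.sum_eq_single a.1 (by intro z _ hz; simp [hz]) (by simp)]
  by_cases h : a.1 = b.1
  · simp [h]
  · simp [h]

lemma conjTranspose_mul_self_apply_self_re {m n : Type*} [Fintype m] (A : Matrix m n ℂ) (b : n) :
    ((Aᴴ * A) b b).re = ∑ a, Complex.normSq (A a b) := by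
  rw [Matrix.mul_apply, Complex.re_sum]
  refine Finset.sum_congr rfl fun a _ => ?_
  rw [Matrix.conjTranspose_apply, ← starRingEnd_apply, ← Complex.normSq_eq_conj_mul_self,
    Complex.ofReal_re]

lemma normSq_ofReal_inv_sqrt (d : ℕ) :
    Complex.normSq (((√(d : ℝ))⁻¹ : ℝ) : ℂ) = 1 / d := by
  rw [Complex.normSq_ofReal, ← mul_inv, Real.mul_self_sqrt (Nat.cast_nonneg d), one_div]

lemma instrumentFactor_gram_diag (ψ : Fin d → (Fin d → ℂ))
    (K : M → J → Matrix (Fin d') (Fin d) ℂ) (b : Fin d × J × M) :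
    (((instrumentFactor ψ K)ᴴ * instrumentFactor ψ K) b b).re =
      (1 / (d : ℝ)) * ∑ i, Complex.normSq ((K b.2.2 b.2.1).mulVec (ψ b.1) i) := by
  rw [conjTranspose_mul_self_apply_self_re, Fintype.sum_prod_type, Finset.mul_sum]
  refine Finset.sum_congr rfl fun i _ => ?_
  rw [Finset.sum_eq_single b.2.2 (by intro m _ hm; simp [instrumentFactor, hm]) (by simp)]
  simp only [instrumentFactor, Matrix.of_apply, if_true]
  rw [Complex.normSq_mul, normSq_ofReal_inv_sqrt]

variable [Fintype J]

lemma cqState_eq (φ : Fin d → (Fin d → ℂ)) (K : M → J → Matrix (Fin d') (Fin d) ℂ) :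
    cqState φ K = instrumentFactorCopy φ K * (instrumentFactorCopy φ K)ᴴ := by
  ext ⟨z, i, m⟩ ⟨z', i', m'⟩
  rw [Matrix.mul_apply, Fintype.sum_prod_type]
  simp_rw [Fintype.sum_prod_type]
  simp only [cqState, instrumentFactorCopy, Matrix.of_apply, Matrix.conjTranspose_apply]
  by_cases h : z = z' ∧ m = m'
  · obtain ⟨rfl, rfl⟩ := h
    rw [Finset.sum_eq_single z (by intro b _ hb; simp [hb.symm]) (by simp), if_pos ⟨rfl, rfl⟩,
      Finset.mul_sum]
    refine Finset.sum_congr rfl fun j _ => ?_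
    rw [Finset.sum_eq_single m (by intro b _ hb; simp [hb.symm]) (by simp),
      ← ofReal_inv_sqrt_mul_self]
    simp only [and_self, if_true, ← starRingEnd_apply, map_mul, Complex.conj_ofReal]
    ring
  · rw [if_neg h]
    symm
    refine Finset.sum_eq_zero fun a _ => Finset.sum_eq_zero fun j _ =>
      Finset.sum_eq_zero fun b _ => ?_
    by_cases h1 : z = a ∧ m = b
    · obtain ⟨rfl, rfl⟩ := h1
      rw [if_neg fun h2 : z' = z ∧ m' = m => h ⟨h2.1.symm, h2.2.symm⟩]
      simp
    · rw [if_neg h1, zero_mul]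

lemma cqStateReduced_eq (φ : Fin d → (Fin d → ℂ)) (K : M → J → Matrix (Fin d') (Fin d) ℂ) :
    cqStateReduced φ K = instrumentFactor φ K * (instrumentFactor φ K)ᴴ := by
  ext ⟨i, m⟩ ⟨i', m'⟩
  rw [Matrix.mul_apply, Fintype.sum_prod_type]
  simp_rw [Fintype.sum_prod_type]
  simp only [cqStateReduced, instrumentFactor, Matrix.of_apply, Matrix.conjTranspose_apply]
  by_cases h : m = m'
  · subst h
    rw [if_pos rfl, Finset.mul_sum]
    refine Finset.sum_congr rfl fun z _ => ?_
    rw [Finset.mul_sum]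
    refine Finset.sum_congr rfl fun j _ => ?_
    rw [Finset.sum_eq_single m (by intro b _ hb; simp [hb.symm]) (by simp),
      ← ofReal_inv_sqrt_mul_self]
    simp only [if_true, ← starRingEnd_apply, map_mul, Complex.conj_ofReal]
    ring
  · rw [if_neg h]
    symm
    refine Finset.sum_eq_zero fun a _ => Finset.sum_eq_zero fun j _ =>
      Finset.sum_eq_zero fun b _ => ?_
    by_cases h1 : m = b
    · subst h1
      rw [if_neg (Ne.symm h)]
      simp
    · rw [if_neg h1, zero_mul]

variable [DecidableEq J]

lemma referenceBasisChange_mul_conjTranspose {φ ψ : Fin d → (Fin d → ℂ)}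
    (hφ : ∀ z z', dotc (φ z) (φ z') = if z = z' then 1 else 0)
    (hψ : ∀ x x', dotc (ψ x) (ψ x') = if x = x' then 1 else 0) :
    referenceBasisChange φ ψ M J * (referenceBasisChange φ ψ M J)ᴴ = 1 := by
  ext ⟨z, y⟩ ⟨z', y'⟩
  rw [Matrix.mul_apply, Fintype.sum_prod_type]
  simp only [referenceBasisChange, Matrix.of_apply, Matrix.conjTranspose_apply]
  have h := congrFun (congrFun (overlap_mul_conjTranspose hφ hψ) z) z'
  rw [Matrix.mul_apply] at h
  simp only [Matrix.conjTranspose_apply, conjTranspose_columnMatrix_mul_apply] at h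
  by_cases hy : y = y'
  · subst hy
    have : ∀ x, ∑ w, (if y = w then dotc (φ z) (ψ x) else 0) *
        star (if y = w then dotc (φ z') (ψ x) else 0) =
        dotc (φ z) (ψ x) * star (dotc (φ z') (ψ x)) := fun x => by
      rw [Finset.sum_eq_single y (by intro w _ hw; simp [hw.symm]) (by simp)]
      simp
    simp_rw [this, h, Matrix.one_apply, Prod.mk.injEq, and_true]
  · rw [Matrix.one_apply_ne (by simp [hy])]
    refine Finset.sum_eq_zero fun x _ => Finset.sum_eq_zero fun w _ => ?_
    by_cases h1 : y = w
    · subst h1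
      simp [Ne.symm hy]
    · simp [h1]

lemma instrumentFactor_mul_basisChange {φ : Fin d → (Fin d → ℂ)}
    (hφ : ∀ z z', dotc (φ z) (φ z') = if z = z' then 1 else 0) (ψ : Fin d → (Fin d → ℂ))
    (K : M → J → Matrix (Fin d') (Fin d) ℂ) :
    instrumentFactor φ K * referenceBasisChange φ ψ M J = instrumentFactor ψ K := by
  ext ⟨i, m⟩ ⟨x, y⟩
  rw [Matrix.mul_apply, Fintype.sum_prod_type]
  simp only [referenceBasisChange, instrumentFactor, Matrix.of_apply]
  rw [← sum_dotc_mul_mulVec _ hφ, Finset.mul_sum]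
  by_cases h : m = y.2
  · rw [if_pos h]
    refine Finset.sum_congr rfl fun z _ => ?_
    rw [Finset.sum_eq_single y (by intro w _ hw; simp [hw]) (by simp), if_pos h, if_pos rfl,
      mul_assoc]
  · rw [if_neg h]
    refine Finset.sum_eq_zero fun z _ => ?_
    rw [Finset.sum_eq_single y (by intro w _ hw; simp [hw]) (by simp), if_neg h, zero_mul]

lemma instrumentFactorCopy_mul_basisChange_apply (φ ψ : Fin d → (Fin d → ℂ))
    (K : M → J → Matrix (Fin d') (Fin d) ℂ) (a : Fin d × Fin d' × M) (b : Fin d × J × M) :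
    (instrumentFactorCopy φ K * referenceBasisChange φ ψ M J) a b =
      if a.2.2 = b.2.2 then
        ((√(d : ℝ))⁻¹ : ℝ) * (K a.2.2 b.2.1).mulVec (φ a.1) a.2.1 * dotc (φ a.1) (ψ b.1)
      else 0 := by
  rw [Matrix.mul_apply, Fintype.sum_prod_type]
  simp only [referenceBasisChange, instrumentFactorCopy, Matrix.of_apply]
  rw [Finset.sum_eq_single a.1 (by intro z _ hz; simp [hz.symm]) (by simp),
    Finset.sum_eq_single b.2 (by intro w _ hw; simp [hw]) (by simp)]
  by_cases h : a.2.2 = b.2.2 <;> simp [h]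

lemma instrumentFactorCopy_gram_diag (φ ψ : Fin d → (Fin d → ℂ))
    (K : M → J → Matrix (Fin d') (Fin d) ℂ) (b : Fin d × J × M) :
    (((instrumentFactorCopy φ K * referenceBasisChange φ ψ M J)ᴴ *
      (instrumentFactorCopy φ K * referenceBasisChange φ ψ M J)) b b).re =
      (1 / (d : ℝ)) * ∑ z, Complex.normSq (dotc (φ z) (ψ b.1)) *
        ∑ i, Complex.normSq ((K b.2.2 b.2.1).mulVec (φ z) i) := by
  rw [conjTranspose_mul_self_apply_self_re, Fintype.sum_prod_type, Finset.mul_sum]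
  refine Finset.sum_congr rfl fun z _ => ?_
  rw [Fintype.sum_prod_type, Finset.mul_sum, Finset.mul_sum]
  refine Finset.sum_congr rfl fun i _ => ?_
  simp_rw [instrumentFactorCopy_mul_basisChange_apply]
  rw [Finset.sum_eq_single b.2.2 (by intro m _ hm; simp [hm]) (by simp), if_pos rfl,
    Complex.normSq_mul, Complex.normSq_mul, normSq_ofReal_inv_sqrt]
  ring

open scoped ComplexOrder in
/-- The relative entropy form of the uncertainty relation, in bits. -/
lemma sum_mul_log_le_entropy_sub {φ ψ : Fin d → (Fin d → ℂ)}
    (hψ : ∀ x x', dotc (ψ x) (ψ x') = if x = x' then 1 else 0)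
    (hφ : ∀ z z', dotc (φ z) (φ z') = if z = z' then 1 else 0)
    (K : M → J → Matrix (Fin d') (Fin d) ℂ)
    (hω : (cqState φ K).IsHermitian) (hωSM : (cqStateReduced φ K).IsHermitian)
    (p q : M × Fin d → ℝ)
    (hp : ∀ mx, p mx =
      (1 / (d : ℝ)) * ∑ j, ∑ i, Complex.normSq ((K mx.1 j).mulVec (ψ mx.2) i))
    (hq : ∀ mx, (1 / (d : ℝ)) * ∑ j, ∑ z, Complex.normSq (dotc (φ z) (ψ mx.2)) *
        ∑ i, Complex.normSq ((K mx.1 j).mulVec (φ z) i) ≤ q mx)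
    (hpq : ∀ mx, p mx ≠ 0 → 0 < q mx) :
    (∑ mx, p mx * (Real.log (p mx) - Real.log (q mx))) / Real.log 2 ≤
      vnEntropy2 hω - vnEntropy2 hωSM := by
  set C := instrumentFactor φ K with hC
  set B := instrumentFactorCopy φ K with hB
  set Y := referenceBasisChange φ ψ M J with hY
  have hYY : Y * Yᴴ = 1 := referenceBasisChange_mul_conjTranspose hφ hψ
  have hYY' : Yᴴ * Y = 1 := mul_eq_one_comm.1 hYY
  have hρ : (Cᴴ * C).IsHermitian := Matrix.isHermitian_conjTranspose_mul_self C
  have hσ : (Bᴴ * B).IsHermitian := Matrix.isHermitian_conjTranspose_mul_self B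
  set U0 := (hρ.eigenvectorUnitary : Matrix (Fin d × J × M) (Fin d × J × M) ℂ) with hU0
  set V0 := (hσ.eigenvectorUnitary : Matrix (Fin d × J × M) (Fin d × J × M) ℂ) with hV0
  set U0 := (hρ.eigenvectorUnitary : Matrix (Fin d × J × M) (Fin d × J × M) ℂ) with hU0
  set V0 := (hσ.eigenvectorUnitary : Matrix (Fin d × J × M) (Fin d × J × M) ℂ) with hV0
  set U0 := (hρ.eigenvectorUnitary : Matrix (Fin d × J × M) (Fin d × J × M) ℂ) with hU0
  set V0 := (hσ.eigenvectorUnitary : Matrix (Fin d × J × M) (Fin d × J × M) ℂ) with hV0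
  set U0 := (hρ.eigenvectorUnitary : Matrix (Fin d × J × M) (Fin d × J × M) ℂ) with hU0
  set V0 := (hσ.eigenvectorUnitary : Matrix (Fin d × J × M) (Fin d × J × M) ℂ) with hV0
  have hunit : ∀ {W : Matrix (Fin d × J × M) (Fin d × J × M) ℂ}, W * Wᴴ = 1 →
      (Yᴴ * W) * (Yᴴ * W)ᴴ = 1 := by
    intro W hW
    rw [Matrix.conjTranspose_mul, Matrix.conjTranspose_conjTranspose]
    calc Yᴴ * W * (Wᴴ * Y) = Yᴴ * (W * Wᴴ) * Y := by simp only [Matrix.mul_assoc]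
      _ = 1 := by rw [hW, Matrix.mul_one, hYY']
  have hρU : (C * Y)ᴴ * (C * Y) = (Yᴴ * U0) *
      Matrix.diagonal (fun k => (hρ.eigenvalues k : ℂ)) * (Yᴴ * U0)ᴴ := by
    calc (C * Y)ᴴ * (C * Y) = Yᴴ * (Cᴴ * C) * Y := by
          rw [Matrix.conjTranspose_mul]; simp only [Matrix.mul_assoc]
      _ = _ := by
          conv_lhs => rw [isHermitian_eq_mul_diagonal hρ]
          rw [Matrix.conjTranspose_mul, Matrix.conjTranspose_conjTranspose]
          simp only [Matrix.mul_assoc, hU0]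
  have hσV : (B * Y)ᴴ * (B * Y) = (Yᴴ * V0) *
      Matrix.diagonal (fun k => (hσ.eigenvalues k : ℂ)) * (Yᴴ * V0)ᴴ := by
    calc (B * Y)ᴴ * (B * Y) = Yᴴ * (Bᴴ * B) * Y := by
          rw [Matrix.conjTranspose_mul]; simp only [Matrix.mul_assoc]
      _ = _ := by
          conv_lhs => rw [isHermitian_eq_mul_diagonal hσ]
          rw [Matrix.conjTranspose_mul, Matrix.conjTranspose_conjTranspose]
          simp only [Matrix.mul_assoc, hV0]
  have hVρV : (Yᴴ * V0)ᴴ * ((C * Y)ᴴ * (C * Y)) * (Yᴴ * V0) = V0ᴴ * (Cᴴ * C) * V0 := by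
    rw [Matrix.conjTranspose_mul, Matrix.conjTranspose_mul, Matrix.conjTranspose_conjTranspose]
    calc V0ᴴ * Y * (Yᴴ * Cᴴ * (C * Y)) * (Yᴴ * V0)
        = V0ᴴ * (Y * Yᴴ) * (Cᴴ * C) * (Y * Yᴴ) * V0 := by simp only [Matrix.mul_assoc]
      _ = _ := by rw [hYY, Matrix.mul_one, Matrix.mul_one]
  have hdeph := sum_diag_mul_of_dephasing (fun a : Fin d × J × M => a.1) V0 (Cᴴ * C) (Bᴴ * B)
    hσ.eigenvalues (eigenvectorUnitary_mul_conjTranspose hσ) (isHermitian_eq_mul_diagonal hσ)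
    (instrumentFactorCopy_gram_apply φ K)
  have hr : ∀ k, 0 ≤ hρ.eigenvalues k :=
    (Matrix.posSemidef_conjTranspose_mul_self C).eigenvalues_nonneg
  have hs : ∀ k, 0 ≤ hσ.eigenvalues k :=
    (Matrix.posSemidef_conjTranspose_mul_self B).eigenvalues_nonneg
  have hpos : ∀ l, 0 ≤ ((V0ᴴ * (Cᴴ * C) * V0) l l).re := fun l => by
    have : V0ᴴ * (Cᴴ * C) * V0 = (C * V0)ᴴ * (C * V0) := by
      rw [Matrix.conjTranspose_mul]; simp only [Matrix.mul_assoc]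
    rw [this, conjTranspose_mul_self_apply_self_re]
    exact Finset.sum_nonneg fun a _ => Complex.normSq_nonneg _
  have hker : ∀ l, hσ.eigenvalues l = 0 → ((V0ᴴ * (Cᴴ * C) * V0) l l).re = 0 := by
    intro l hl
    have h0 := hdeph fun t => if t = 0 then 1 else 0
    have h1 : ∑ l, hσ.eigenvalues l * (if hσ.eigenvalues l = 0 then (1 : ℝ) else 0) = 0 :=
      Finset.sum_eq_zero fun l _ => by split_ifs with h <;> simp [h]
    rw [h1, Finset.sum_eq_zero_iff_of_nonneg fun l _ =>
      mul_nonneg (hpos l) (by split_ifs <;> norm_num)] at h0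
    simpa [hl] using h0 l (Finset.mem_univ l)
  have hfiber : ∀ (g : Fin d × J × M → ℝ) (mx : M × Fin d),
      ∑ b with (b.2.2, b.1) = mx, g b = ∑ j, g (mx.2, j, mx.1) := by
    rintro g ⟨m, x⟩
    rw [Finset.sum_filter, Fintype.sum_prod_type,
      Finset.sum_eq_single x (by intro y _ hy; simp [hy]) (by simp), Fintype.sum_prod_type]
    refine Finset.sum_congr rfl fun j _ => ?_
    rw [Finset.sum_eq_single m (by intro y _ hy; simp [hy]) (by simp), if_pos rfl]
  have main := measured_relative_entropy_le (Yᴴ * U0) (Yᴴ * V0) _ _ hρ.eigenvalues hσ.eigenvalues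
    (hunit (eigenvectorUnitary_mul_conjTranspose hρ))
    (hunit (eigenvectorUnitary_mul_conjTranspose hσ)) hρU hσV hr hs
    (by rw [hVρV]; exact hker) (fun b : Fin d × J × M => (b.2.2, b.1)) p q ?_ ?_ hpq
  · rw [hVρV, hdeph Real.log] at main
    rw [vnEntropy2_mul_conjTranspose_comm B (cqState_eq φ K) hω hσ,
      vnEntropy2_mul_conjTranspose_comm C (cqStateReduced_eq φ K) hωSM hρ,
      vnEntropy2_eq_log, vnEntropy2_eq_log, ← sub_div]
    exact div_le_div_of_nonneg_right (by linarith) (Real.log_nonneg one_le_two)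
  · intro mx
    rw [hfiber, hp, Finset.mul_sum, hC, hY, instrumentFactor_mul_basisChange hφ]
    exact Finset.sum_congr rfl fun j _ => by rw [instrumentFactor_gram_diag]
  · intro mx
    refine le_trans (le_of_eq ?_) (hq mx)
    rw [hfiber, Finset.mul_sum]
    exact Finset.sum_congr rfl fun j _ => by rw [hB, hY, instrumentFactorCopy_gram_diag]

end Instrument

lemma sum_normSq_kraus {d d' : ℕ} {M J : Type*} [Fintype M] [Fintype J]
    {ψ : Fin d → (Fin d → ℂ)}
    (hψ : ∀ x x', dotc (ψ x) (ψ x') = if x = x' then 1 else 0)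
    (K : M → J → Matrix (Fin d') (Fin d) ℂ) (hK : ∑ m, ∑ j, (K m j)ᴴ * K m j = 1) :
    ∑ m, ∑ x, ∑ j, ∑ i, Complex.normSq ((K m j).mulVec (ψ x) i) = d := by
  have h1 : ∀ m, ∑ x, ∑ j, ∑ i, Complex.normSq ((K m j).mulVec (ψ x) i) =
      ∑ j, ∑ k, (((K m j)ᴴ * K m j) k k).re := fun m => by
    rw [Finset.sum_comm]
    refine Finset.sum_congr rfl fun j _ => ?_
    simp_rw [conjTranspose_mul_self_apply_self_re]
    rw [Finset.sum_comm]
    simp_rw [sum_normSq_mulVec _ hψ]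
    exact Finset.sum_comm
  have h2 := congrArg (fun A : Matrix (Fin d) (Fin d) ℂ => A.trace.re) hK
  simp only [Matrix.trace_sum, Complex.re_sum, Matrix.trace_one, Fintype.card_fin,
    Complex.natCast_re] at h2
  simp_rw [h1, ← h2]
  simp [Matrix.trace]

/-- **Quantum lower bound on disturbance (Eq. (4)).**
`H(X|M) + H(Z|S'M) ≥ -log₂ c`, where `H(Z|S'M) = S(ω) - S(ω_{S'M})` is the conditional
von Neumann entropy of the classical–quantum state `ω`. -/
theorem quantum_lower_bound_disturbance
    {d d' : ℕ} (hd : 0 < d)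
    {M J : Type*} [Fintype M] [Fintype J] [DecidableEq M]
    (ψ φ : Fin d → (Fin d → ℂ))
    (hψ : ∀ x x', dotc (ψ x) (ψ x') = if x = x' then 1 else 0)
    (hφ : ∀ z z', dotc (φ z) (φ z') = if z = z' then 1 else 0)
    (K : M → J → Matrix (Fin d') (Fin d) ℂ)
    (hK : ∑ m, ∑ j, (K m j)ᴴ * K m j = 1)
    (hω : (cqState φ K).IsHermitian)
    (hωSM : (cqStateReduced φ K).IsHermitian) :
    condEntropy2 (fun mx : M × Fin d =>
        (1 / (d : ℝ)) * ∑ j, ∑ i, Complex.normSq ((K mx.1 j).mulVec (ψ mx.2) i))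
      + (vnEntropy2 hω - vnEntropy2 hωSM)
      ≥ - Real.logb 2 (⨆ xz : Fin d × Fin d, Complex.normSq (dotc (ψ xz.1) (φ xz.2))) := by
  classical
  set p : M × Fin d → ℝ := fun mx =>
    (1 / (d : ℝ)) * ∑ j, ∑ i, Complex.normSq ((K mx.1 j).mulVec (ψ mx.2) i) with hp
  set c : ℝ := ⨆ xz : Fin d × Fin d, Complex.normSq (dotc (ψ xz.1) (φ xz.2)) with hc
  set P : M → ℝ := fun m => ∑ x, p (m, x) with hP
  have hd' : (0 : ℝ) < d := Nat.cast_pos.2 hd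
  have hcle : ∀ x z, Complex.normSq (dotc (φ z) (ψ x)) ≤ c := fun x z => by
    rw [normSq_dotc_comm]
    exact le_ciSup (f := fun xz : Fin d × Fin d => Complex.normSq (dotc (ψ xz.1) (φ xz.2)))
      (Set.finite_range _).bddAbove (x, z)
  have hc0 : 0 < c := by
    by_contra! hneg
    have h := sum_normSq_col_eq_one (overlap_mul_conjTranspose hφ hψ) ⟨0, hd⟩
    simp only [conjTranspose_columnMatrix_mul_apply] at h
    have := Finset.sum_nonpos fun z (_ : z ∈ Finset.univ) => (hcle ⟨0, hd⟩ z).trans hneg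
    linarith
  have hp0 : ∀ mx, 0 ≤ p mx := fun mx => mul_nonneg (by positivity)
    (Finset.sum_nonneg fun j _ => Finset.sum_nonneg fun i _ => Complex.normSq_nonneg _)
  have hPpos : ∀ mx, p mx ≠ 0 → 0 < P mx.1 := fun mx hne =>
    (lt_of_le_of_ne (hp0 mx) hne.symm).trans_le
      (Finset.single_le_sum (f := fun x => p (mx.1, x)) (fun x _ => hp0 _)
        (Finset.mem_univ mx.2))
  have hp1 : ∑ mx, p mx = 1 := by
    rw [Fintype.sum_prod_type]
    simp only [hp, ← Finset.mul_sum]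
    rw [sum_normSq_kraus hψ K hK, one_div, inv_mul_cancel₀ hd'.ne']
  have hPφ : ∀ m, P m =
      (1 / (d : ℝ)) * ∑ j, ∑ z, ∑ i, Complex.normSq ((K m j).mulVec (φ z) i) := fun m => by
    simp only [hP, hp, ← Finset.mul_sum]
    rw [Finset.sum_comm]
    congr 1
    refine Finset.sum_congr rfl fun j _ => ?_
    rw [Finset.sum_comm]
    simp_rw [sum_normSq_mulVec _ hψ, ← sum_normSq_mulVec _ hφ]
    exact Finset.sum_comm
  have key := sum_mul_log_le_entropy_sub hψ hφ K hω hωSM p (fun mx => c * P mx.1)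
    (fun _ => rfl) (fun mx => ?_) (fun mx hne => mul_pos hc0 (hPpos mx hne))
  · have hlog : ∑ mx, p mx * (Real.log (p mx) - Real.log (c * P mx.1)) =
        ∑ mx, p mx * Real.log (p mx) - Real.log c - ∑ m, P m * Real.log (P m) := by
      have e1 : ∀ mx, p mx * (Real.log (p mx) - Real.log (c * P mx.1)) =
          p mx * Real.log (p mx) - p mx * Real.log c - p mx * Real.log (P mx.1) := fun mx => by
        rcases eq_or_ne (p mx) 0 with h | h
        · simp [h]
        · rw [Real.log_mul hc0.ne' (hPpos mx h).ne']
          ring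
      simp_rw [e1, Finset.sum_sub_distrib, ← Finset.sum_mul, hp1, one_mul]
      congr 1
      rw [Fintype.sum_prod_type]
      exact Finset.sum_congr rfl fun m _ =>
        (Finset.sum_mul Finset.univ (fun x => p (m, x)) (Real.log (P m))).symm
    rw [hlog] at key
    have hH : condEntropy2 p =
        (∑ m, P m * Real.log (P m) - ∑ mx, p mx * Real.log (p mx)) / Real.log 2 := by
      simp only [condEntropy2, entropy2, Real.logb, Finset.sum_neg_distrib, sub_div,
        Finset.sum_div, mul_div_assoc]
      rw [neg_sub_neg]
    have hsplit : (∑ mx, p mx * Real.log (p mx) - Real.log c - ∑ m, P m * Real.log (P m)) /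
        Real.log 2 = -condEntropy2 p - Real.logb 2 c := by
      rw [hH, Real.logb]
      ring
    rw [hsplit] at key
    linarith
  · simp only [hPφ]
    rw [mul_left_comm, Finset.mul_sum _ _ c]
    refine mul_le_mul_of_nonneg_left (Finset.sum_le_sum fun j _ => ?_) (by positivity)
    rw [Finset.mul_sum]
    exact Finset.sum_le_sum fun z _ => mul_le_mul_of_nonneg_right (hcle _ _)
      (Finset.sum_nonneg fun i _ => Complex.normSq_nonneg _)
end

section
/- Mean-square-deviation noise–disturbance tradeoff (Eq. (6)). Let d ≥ 1, let {ψ^x}_{x ∈ Fin d} and {φ^z}_{z ∈ Fin d} be two orthonormal bases of ℂ^d, let a quantum instrument be given by Kraus operators K(m,j), and let a correction operation be given by Kraus operators E(m,l); define p_N(m,x) := (1/d) ∑_{j∈J} ‖K(m,j) ψ^x‖² and p_D(ẑ,z) := (1/d) ∑_{m,j,l} |⟨φ^{ẑ}, E(m,l) K(m,j) φ^z⟩|². Let ξ, ζ : Fin d → ℝ be injective eigenvalue assignments and s_X, s_Z > 0 be such that every difference ξ(x) − ξ(x') is an integer multiple of s_X and every difference ζ(z) − ζ(z') is an integer multiple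 of s_Z. For any estimator f : M → ℝ, define the mean square deviations V_N := ∑_{m,x} p_N(m,x) (f(m) − ξ(x))² and V_D := ∑_{ẑ,z} p_D(ẑ,z) (ζ(ẑ) − ζ(z))². Then (V_N + s_X²/12) · (V_D + s_Z²/12) ≥ (s_X s_Z / (2π e c))², where c := max_{x,z} |⟨ψ^x, φ^z⟩|². -/
open scoped BigOperators Matrix

section LatticeEntropy

open MeasureTheory ProbabilityTheory

variable {ι : Type*} [Fintype ι]

/-- Gibbs' inequality. -/
lemma sum_negMulLog_le {p q : ι → ℝ} (hp : ∀ x, 0 ≤ p x) (hp1 : ∑ x, p x = 1)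
    (hq : ∀ x, 0 < q x) (hq1 : ∑ x, q x ≤ 1) :
    ∑ x, Real.negMulLog (p x) ≤ -∑ x, p x * Real.log (q x) := by
  have h : ∀ x, Real.negMulLog (p x) + p x * Real.log (q x) ≤ q x - p x := by
    intro x
    rcases (hp x).eq_or_lt with h | h
    · simpa [← h] using (hq x).le
    · have h2 := mul_le_mul_of_nonneg_left
        (Real.log_le_sub_one_of_pos (div_pos (hq x) h)) h.le
      rw [Real.log_div (hq x).ne' h.ne', mul_sub, mul_sub, mul_div_cancel₀ _ h.ne'] at h2
      rw [Real.negMulLog]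
      linarith
  have h3 := Finset.sum_le_sum fun x (_ : x ∈ Finset.univ) => h x
  rw [Finset.sum_add_distrib, Finset.sum_sub_distrib, hp1] at h3
  linarith

/-- Jensen's inequality for a Gaussian density on an interval. -/
lemma mul_gaussian_le_setIntegral {v : NNReal} (hv : v ≠ 0) (a b s : ℝ) (hs : 0 < s) :
    s * ((√(2 * Real.pi * v))⁻¹ * Real.exp (-((b - a) ^ 2 + s ^ 2 / 12) / (2 * v))) ≤
      ∫ y in Set.Ioc (b - s / 2) (b + s / 2), gaussianPDFReal a v y := by
  have hv' : (v : ℝ) ≠ 0 := by exact_mod_cast hv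
  have hle : b - s / 2 ≤ b + s / 2 := by linarith
  rw [← intervalIntegral.integral_of_le hle]
  set C := (√(2 * Real.pi * v))⁻¹ * Real.exp (-((b - a) ^ 2 + s ^ 2 / 12) / (2 * v)) with hC
  have hC0 : 0 ≤ C := by positivity
  have key : ∀ y, C * (1 + ((b - a) ^ 2 + s ^ 2 / 12 - (y - a) ^ 2) / (2 * v)) ≤
      gaussianPDFReal a v y := by
    intro y
    rw [gaussianPDFReal_def, hC, mul_assoc]
    have h1 : -(y - a) ^ 2 / (2 * (v : ℝ)) = -((b - a) ^ 2 + s ^ 2 / 12) / (2 * v) +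
        ((b - a) ^ 2 + s ^ 2 / 12 - (y - a) ^ 2) / (2 * v) := by ring
    simp only [h1, Real.exp_add]
    gcongr
    linarith [Real.add_one_le_exp (((b - a) ^ 2 + s ^ 2 / 12 - (y - a) ^ 2) / (2 * (v : ℝ)))]
  have hint : ∫ y in (b - s / 2)..(b + s / 2),
      C * (1 + ((b - a) ^ 2 + s ^ 2 / 12 - (y - a) ^ 2) / (2 * v)) = s * C := by
    have hderiv : ∀ y ∈ Set.uIcc (b - s / 2) (b + s / 2), HasDerivAt
        (fun y => C * (y + (((b - a) ^ 2 + s ^ 2 / 12) * y - (y - a) ^ 3 / 3) / (2 * v)))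
        (C * (1 + ((b - a) ^ 2 + s ^ 2 / 12 - (y - a) ^ 2) / (2 * v))) y := by
      intro y _
      have h1 := (((hasDerivAt_id y).sub_const a).fun_pow 3).div_const 3
      have h2 := (hasDerivAt_id y).const_mul ((b - a) ^ 2 + s ^ 2 / 12)
      refine (((hasDerivAt_id y).add ((h2.sub h1).div_const (2 * (v : ℝ)))).const_mul
        C).congr_deriv ?_
      simp
    rw [intervalIntegral.integral_eq_sub_of_hasDerivAt hderiv
      (Continuous.intervalIntegrable (by fun_prop) _ _)]
    field_simp
    ring
  rw [← hint]
  refine intervalIntegral.integral_mono_on hle (Continuous.intervalIntegrable (by fun_prop) _ _)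
    (integrable_gaussianPDFReal a v).intervalIntegrable fun y _ => key y

/-- The entropy of a distribution on `s`-separated reals is bounded by its mean square
deviation from any point. -/
theorem sum_negMulLog_le_log_msd {p ξ : ι → ℝ} (hp : ∀ x, 0 ≤ p x) (hp1 : ∑ x, p x = 1)
    {s : ℝ} (hs : 0 < s) (hsep : ∀ x y, x ≠ y → s ≤ |ξ x - ξ y|) (a : ℝ) :
    ∑ x, Real.negMulLog (p x) ≤
      1 / 2 * Real.log (2 * Real.pi * Real.exp 1 *
        (∑ x, p x * (a - ξ x) ^ 2 + s ^ 2 / 12) / s ^ 2) := by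
  have hV0 : 0 ≤ ∑ x, p x * (a - ξ x) ^ 2 :=
    Finset.sum_nonneg fun x _ => mul_nonneg (hp x) (sq_nonneg _)
  set V := ∑ x, p x * (a - ξ x) ^ 2 with hV
  have hσ : 0 < V + s ^ 2 / 12 := by positivity
  lift V + s ^ 2 / 12 to NNReal using hσ.le with v hv
  have hv0 : v ≠ 0 := by rintro rfl; simp at hσ
  set q : ι → ℝ := fun x => s * ((√(2 * Real.pi * v))⁻¹ *
    Real.exp (-((ξ x - a) ^ 2 + s ^ 2 / 12) / (2 * v))) with hq
  have hq0 : ∀ x, 0 < q x := fun x => by positivity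
  have hq1 : ∑ x, q x ≤ 1 := by
    have hdisj : (↑(Finset.univ : Finset ι) : Set ι).Pairwise (Function.onFun Disjoint
        fun x => Set.Ioc (ξ x - s / 2) (ξ x + s / 2)) := by
      intro x _ y _ hxy
      rw [Function.onFun, Set.disjoint_left]
      rintro t ⟨h1, h2⟩ ⟨h3, h4⟩
      rcases le_abs.1 (hsep x y hxy) with h | h <;> linarith
    refine (Finset.sum_le_sum fun x _ => mul_gaussian_le_setIntegral hv0 a (ξ x) s hs).trans ?_
    rw [← integral_biUnion_finset Finset.univ (fun x _ => measurableSet_Ioc) hdisj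
      (fun x _ => (integrable_gaussianPDFReal a v).integrableOn),
      ← integral_gaussianPDFReal_eq_one a hv0]
    exact setIntegral_le_integral (integrable_gaussianPDFReal a v)
      (Filter.Eventually.of_forall fun y => gaussianPDFReal_nonneg a v y)
  refine (sum_negMulLog_le hp hp1 hq0 hq1).trans (le_of_eq ?_)
  have hlogq : ∀ x, Real.log (q x) = (Real.log s - 1 / 2 * Real.log (2 * Real.pi * v)) -
      ((a - ξ x) ^ 2 + s ^ 2 / 12) / (2 * v) := by
    intro x
    rw [hq, Real.log_mul hs.ne' (by positivity), Real.log_mul (by positivity) (by positivity),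
      Real.log_inv, Real.log_sqrt (by positivity), Real.log_exp]
    ring
  have hsum : ∑ x, p x * Real.log (q x) =
      (Real.log s - 1 / 2 * Real.log (2 * Real.pi * v)) - 1 / 2 := by
    have : ∀ x, p x * Real.log (q x) =
        p x * ((Real.log s - 1 / 2 * Real.log (2 * Real.pi * v)) - s ^ 2 / 12 / (2 * v)) -
        p x * (a - ξ x) ^ 2 / (2 * v) := fun x => by rw [hlogq]; ring
    simp_rw [this]
    rw [Finset.sum_sub_distrib, ← Finset.sum_mul, ← Finset.sum_div, hp1, ← hV]
    have : V = v - s ^ 2 / 12 := by rw [hv]; ring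
    rw [this]
    field_simp
    ring
  rw [hsum, Real.log_div (by positivity) (by positivity),
    show 2 * Real.pi * Real.exp 1 * (v : ℝ) = 2 * Real.pi * v * Real.exp 1 by ring,
    Real.log_mul (x := 2 * Real.pi * v) (by positivity) (by positivity), Real.log_exp,
    Real.log_pow]
  push_cast
  ring

end LatticeEntropy

section MaassenUffink

variable {ι H : Type*} [Fintype ι] [NormedAddCommGroup H] [InnerProductSpace ℂ H]

/-- The analytic family interpolating between the `ℓ²` and `ℓ¹` bounds of the overlap matrix of
two orthonormal bases. -/
noncomputable def overlapInterp (e g : OrthonormalBasis ι ℂ H) (v : H) (w : ℂ) : ℂ :=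
  ∑ x, ∑ z, (inner ℂ v (e x) * Complex.exp (w * (Real.log ‖inner ℂ (e x) v‖ : ℝ))) *
    (inner ℂ (e x) (g z) *
      (inner ℂ (g z) v * Complex.exp (w * (Real.log ‖inner ℂ (g z) v‖ : ℝ))))

lemma norm_sum_phase_smul (e : OrthonormalBasis ι ℂ H) (v : H) (u : ι → ℂ)
    (hu : ∀ x, ‖u x‖ = 1) : ‖∑ x, (inner ℂ (e x) v * u x) • e x‖ = ‖v‖ := by
  rw [← sq_eq_sq₀ (norm_nonneg _) (norm_nonneg _), ← e.sum_sq_norm_inner_right,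
    ← e.sum_sq_norm_inner_right v]
  refine Finset.sum_congr rfl fun x _ => ?_
  rw [e.orthonormal.inner_right_fintype, norm_mul, hu, mul_one]

lemma norm_cexp_mul_ofReal (w : ℂ) (r : ℝ) : ‖Complex.exp (w * r)‖ = Real.exp (w.re * r) := by
  simp [Complex.norm_exp]

lemma norm_overlapInterp_le_of_re_eq_zero (e g : OrthonormalBasis ι ℂ H) {v : H} (hv : ‖v‖ = 1)
    {w : ℂ} (hw : w.re = 0) : ‖overlapInterp e g v w‖ ≤ 1 := by
  set a := ∑ x, (inner ℂ (e x) v *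
    (starRingEnd ℂ) (Complex.exp (w * (Real.log ‖inner ℂ (e x) v‖ : ℝ)))) • e x with ha
  set b := ∑ z, (inner ℂ (g z) v *
    Complex.exp (w * (Real.log ‖inner ℂ (g z) v‖ : ℝ))) • g z with hb
  have hna : ‖a‖ = 1 := by
    rw [ha, norm_sum_phase_smul e v, hv]
    intro x
    rw [RCLike.norm_conj, norm_cexp_mul_ofReal, hw]; simp
  have hnb : ‖b‖ = 1 := by
    rw [hb, norm_sum_phase_smul g v, hv]
    intro x
    rw [norm_cexp_mul_ofReal, hw]; simp
  have hF : overlapInterp e g v w = inner ℂ a b := by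
    rw [← e.sum_inner_mul_inner a b]
    refine Finset.sum_congr rfl fun x _ => ?_
    have h1 : inner ℂ a (e x) =
        inner ℂ v (e x) * Complex.exp (w * (Real.log ‖inner ℂ (e x) v‖ : ℝ)) := by
      rw [← inner_conj_symm, ha, e.orthonormal.inner_right_fintype, map_mul, inner_conj_symm,
        Complex.conj_conj]
    rw [h1, hb, inner_sum, Finset.mul_sum]
    refine Finset.sum_congr rfl fun z _ => ?_
    rw [inner_smul_right]
    ring
  rw [hF]
  simpa [hna, hnb] using norm_inner_le_norm (𝕜 := ℂ) a b

lemma norm_mul_exp_log_norm (z : ℂ) : ‖z‖ * Real.exp (Real.log ‖z‖) = ‖z‖ ^ 2 := by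
  rcases eq_or_ne z 0 with rfl | h
  · simp
  · rw [Real.exp_log (norm_pos_iff.2 h), sq]

lemma norm_overlapInterp_le_of_re_eq_one (e g : OrthonormalBasis ι ℂ H) {v : H} (hv : ‖v‖ = 1)
    {r : ℝ} (hr : ∀ x z, ‖inner ℂ (e x) (g z)‖ ≤ r) {w : ℂ} (hw : w.re = 1) :
    ‖overlapInterp e g v w‖ ≤ r := by
  have key : ∑ x, ∑ z, ‖inner ℂ (e x) v‖ ^ 2 * (r * ‖inner ℂ (g z) v‖ ^ 2) = r := by
    simp_rw [← Finset.mul_sum, ← Finset.sum_mul]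
    rw [e.sum_sq_norm_inner_right, g.sum_sq_norm_inner_right, hv]; simp
  rw [← key]
  refine (norm_sum_le _ _).trans (Finset.sum_le_sum fun x _ => ?_)
  refine (norm_sum_le _ _).trans (Finset.sum_le_sum fun z _ => ?_)
  rw [norm_mul, norm_mul, norm_mul, norm_mul, norm_cexp_mul_ofReal, norm_cexp_mul_ofReal, hw,
    one_mul, one_mul, norm_inner_symm v, norm_mul_exp_log_norm, norm_mul_exp_log_norm]
  gcongr
  exact hr x z

lemma bddAbove_norm_overlapInterp (e g : OrthonormalBasis ι ℂ H) (v : H) :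
    BddAbove ((norm ∘ overlapInterp e g v) ''
      Complex.HadamardThreeLines.verticalClosedStrip 0 1) := by
  refine ⟨∑ x, ∑ z, (‖inner ℂ v (e x)‖ * Real.exp |Real.log ‖inner ℂ (e x) v‖|) *
    (‖inner ℂ (e x) (g z)‖ *
      (‖inner ℂ (g z) v‖ * Real.exp |Real.log ‖inner ℂ (g z) v‖|)), ?_⟩
  rintro _ ⟨w, hw, rfl⟩
  have hexp : ∀ l : ℝ, ‖Complex.exp (w * l)‖ ≤ Real.exp |l| := by
    intro l
    rw [norm_cexp_mul_ofReal]
    refine Real.exp_le_exp.2 ((le_abs_self _).trans ?_)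
    rw [abs_mul, abs_of_nonneg hw.1]
    exact mul_le_of_le_one_left (abs_nonneg _) hw.2
  refine (norm_sum_le _ _).trans (Finset.sum_le_sum fun x _ => ?_)
  refine (norm_sum_le _ _).trans (Finset.sum_le_sum fun z _ => ?_)
  rw [norm_mul, norm_mul, norm_mul, norm_mul]
  gcongr <;> exact hexp _

lemma differentiable_overlapInterp (e g : OrthonormalBasis ι ℂ H) (v : H) :
    Differentiable ℂ (overlapInterp e g v) := by
  unfold overlapInterp
  fun_prop

lemma hasDerivAt_overlapInterp_zero (e g : OrthonormalBasis ι ℂ H) (v : H) :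
    HasDerivAt (overlapInterp e g v)
      ((∑ x, ‖inner ℂ (e x) v‖ ^ 2 * Real.log ‖inner ℂ (e x) v‖ +
        ∑ z, ‖inner ℂ (g z) v‖ ^ 2 * Real.log ‖inner ℂ (g z) v‖ : ℝ) : ℂ) 0 := by
  have hexp : ∀ l : ℝ, HasDerivAt (fun w : ℂ => Complex.exp (w * l)) (l : ℂ) 0 := by
    intro l
    simpa using ((hasDerivAt_id (0 : ℂ)).mul_const (l : ℂ)).cexp
  have h : HasDerivAt (overlapInterp e g v)
      (∑ x, ∑ z, (inner ℂ v (e x) * (Real.log ‖inner ℂ (e x) v‖ : ℝ) *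
          (inner ℂ (e x) (g z) * inner ℂ (g z) v) +
        inner ℂ v (e x) * inner ℂ (e x) (g z) *
          (inner ℂ (g z) v * (Real.log ‖inner ℂ (g z) v‖ : ℝ)))) 0 := by
    unfold overlapInterp
    refine HasDerivAt.fun_sum fun x _ => HasDerivAt.fun_sum fun z _ => ?_
    refine (((hexp _).const_mul (inner ℂ v (e x))).fun_mul
      (((hexp _).const_mul (inner ℂ (g z) v)).const_mul (inner ℂ (e x) (g z)))).congr_deriv ?_
    simp
    ring
  convert! h using 1
  simp_rw [Finset.sum_add_distrib]
  rw [Finset.sum_comm (f := fun x z => inner ℂ v (e x) * inner ℂ (e x) (g z) *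
          (inner ℂ (g z) v * ((Real.log ‖inner ℂ (g z) v‖ : ℝ) : ℂ)))]
  simp_rw [← Finset.mul_sum, ← Finset.sum_mul, OrthonormalBasis.sum_inner_mul_inner]
  have hn : ∀ y : H, ((‖inner ℂ y v‖ : ℝ) : ℂ) ^ 2 = inner ℂ v y * inner ℂ y v := by
    intro y
    rw [← inner_conj_symm v y, Complex.conj_mul']
  push_cast
  simp_rw [hn]
  congr 1 <;> refine Finset.sum_congr rfl fun x _ => ?_ <;> ring

/-- A function that is nonpositive to the right of a zero has nonpositive derivative there. -/
lemma HasDerivAt.nonpos_of_nonpos_right {f : ℝ → ℝ} {f' : ℝ} (hf : HasDerivAt f f' 0)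
    (h0 : f 0 = 0) (h : ∀ t ∈ Set.Ioo (0 : ℝ) 1, f t ≤ 0) : f' ≤ 0 := by
  have ht := hf.tendsto_slope.mono_left
    (nhdsWithin_mono (0 : ℝ) (s := Set.Ioi 0) fun t (ht : 0 < t) => ht.ne')
  refine le_of_tendsto ht ?_
  filter_upwards [Ioo_mem_nhdsGT (zero_lt_one' ℝ)] with t ht
  rw [slope_def_field, h0, sub_zero, sub_zero]
  exact div_nonpos_of_nonpos_of_nonneg (h t ht) ht.1.le

/-- **Maassen–Uffink entropic uncertainty relation** for a unit vector. -/
theorem maassen_uffink (e g : OrthonormalBasis ι ℂ H) {v : H} (hv : ‖v‖ = 1) {c : ℝ} (hc : 0 < c)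
    (hU : ∀ x z, ‖inner ℂ (e x) (g z)‖ ^ 2 ≤ c) :
    -Real.log c ≤ ∑ x, Real.negMulLog (‖inner ℂ (e x) v‖ ^ 2) +
      ∑ z, Real.negMulLog (‖inner ℂ (g z) v‖ ^ 2) := by
  have hF := differentiable_overlapInterp e g v
  have hbound : ∀ t ∈ Set.Ioo (0 : ℝ) 1,
      (overlapInterp e g v t).re ≤ Real.exp (Real.log (√c) * t) := by
    intro t ht
    refine (Complex.re_le_norm _).trans ?_
    have := Complex.HadamardThreeLines.norm_le_interp_of_mem_verticalClosedStrip'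
      (f := overlapInterp e g v) (z := (t : ℂ)) (a := 1) (b := √c) zero_lt_one
      ⟨ht.1.le, ht.2.le⟩ hF.diffContOnCl (bddAbove_norm_overlapInterp e g v)
      (fun w hw => norm_overlapInterp_le_of_re_eq_zero e g hv hw)
      (fun w hw => norm_overlapInterp_le_of_re_eq_one e g hv
        (fun x z => Real.le_sqrt_of_sq_le (hU x z)) hw)
    simpa [Real.rpow_def_of_pos (Real.sqrt_pos.2 hc)] using this
  have hd := (hasDerivAt_overlapInterp_zero e g v).real_of_complex (z := 0)
  have hd2 := ((hasDerivAt_id (0 : ℝ)).const_mul (Real.log √c)).exp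
  have h0 : overlapInterp e g v 0 = 1 := by
    simp only [overlapInterp, zero_mul, Complex.exp_zero, mul_one, ← Finset.mul_sum,
      OrthonormalBasis.sum_inner_mul_inner]
    rw [inner_self_eq_norm_sq_to_K, hv]; simp
  have := (hd.sub hd2).nonpos_of_nonpos_right (by simp [h0])
    (fun t ht => sub_nonpos.2 (hbound t ht))
  simp only [id, mul_zero, Real.exp_zero, mul_one, one_mul, Complex.ofReal_re,
    Real.log_sqrt hc.le] at this
  simp only [Real.negMulLog, Real.log_pow, Nat.cast_ofNat]
  have h2 : ∀ b : OrthonormalBasis ι ℂ H, ∑ x, -‖inner ℂ (b x) v‖ ^ 2 *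
      (2 * Real.log ‖inner ℂ (b x) v‖) =
      -2 * ∑ x, ‖inner ℂ (b x) v‖ ^ 2 * Real.log ‖inner ℂ (b x) v‖ := by
    intro b
    rw [Finset.mul_sum]
    exact Finset.sum_congr rfl fun x _ => by ring
  rw [h2, h2]
  linarith

end MaassenUffink

section StateTradeoff

variable {ι H : Type*} [Fintype ι] [NormedAddCommGroup H] [InnerProductSpace ℂ H]

lemma sq_le_msd_mul_msd_of_norm_eq_one (e g : OrthonormalBasis ι ℂ H) {c : ℝ} (hc : 0 < c)
    (hU : ∀ x z, ‖inner ℂ (e x) (g z)‖ ^ 2 ≤ c) {ξ ζ : ι → ℝ} {s t : ℝ} (hs : 0 < s) (ht : 0 < t)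
    (hξ : ∀ x y, x ≠ y → s ≤ |ξ x - ξ y|) (hζ : ∀ x y, x ≠ y → t ≤ |ζ x - ζ y|) (a b : ℝ)
    {v : H} (hv : ‖v‖ = 1) :
    (s * t / (2 * Real.pi * Real.exp 1 * c)) ^ 2 ≤
      (∑ x, ‖inner ℂ (e x) v‖ ^ 2 * (a - ξ x) ^ 2 + s ^ 2 / 12) *
      (∑ z, ‖inner ℂ (g z) v‖ ^ 2 * (b - ζ z) ^ 2 + t ^ 2 / 12) := by
  have h1 := sum_negMulLog_le_log_msd (p := fun x => ‖inner ℂ (e x) v‖ ^ 2)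
    (fun x => sq_nonneg _) (by rw [e.sum_sq_norm_inner_right, hv, one_pow]) hs hξ a
  have h2 := sum_negMulLog_le_log_msd (p := fun x => ‖inner ℂ (g x) v‖ ^ 2)
    (fun x => sq_nonneg _) (by rw [g.sum_sq_norm_inner_right, hv, one_pow]) ht hζ b
  have h3 := maassen_uffink e g hv hc hU
  set A := ∑ x, ‖inner ℂ (e x) v‖ ^ 2 * (a - ξ x) ^ 2 + s ^ 2 / 12
  set B := ∑ z, ‖inner ℂ (g z) v‖ ^ 2 * (b - ζ z) ^ 2 + t ^ 2 / 12
  have hA : 0 < A := add_pos_of_nonneg_of_pos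
    (Finset.sum_nonneg fun x _ => by positivity) (by positivity)
  have hB : 0 < B := add_pos_of_nonneg_of_pos
    (Finset.sum_nonneg fun x _ => by positivity) (by positivity)
  have h4 : Real.log ((c⁻¹) ^ 2) ≤ Real.log ((2 * Real.pi * Real.exp 1 * A / s ^ 2) *
      (2 * Real.pi * Real.exp 1 * B / t ^ 2)) := by
    rw [Real.log_mul (by positivity) (by positivity), Real.log_pow, Real.log_inv]
    push_cast
    linarith
  have h5 := (Real.log_le_log_iff (by positivity) (by positivity)).1 h4
  calc (s * t / (2 * Real.pi * Real.exp 1 * c)) ^ 2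
      = (s * t / (2 * Real.pi * Real.exp 1)) ^ 2 * (c⁻¹) ^ 2 := by field_simp
    _ ≤ (s * t / (2 * Real.pi * Real.exp 1)) ^ 2 * ((2 * Real.pi * Real.exp 1 * A / s ^ 2) *
      (2 * Real.pi * Real.exp 1 * B / t ^ 2)) := by gcongr
    _ = A * B := by field_simp

/-- The mean square deviation tradeoff for a single, unnormalized pure state. -/
theorem sq_le_msd_mul_msd (e g : OrthonormalBasis ι ℂ H) {c : ℝ} (hc : 0 < c)
    (hU : ∀ x z, ‖inner ℂ (e x) (g z)‖ ^ 2 ≤ c) {ξ ζ : ι → ℝ} {s t : ℝ} (hs : 0 < s) (ht : 0 < t)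
    (hξ : ∀ x y, x ≠ y → s ≤ |ξ x - ξ y|) (hζ : ∀ x y, x ≠ y → t ≤ |ζ x - ζ y|) (a b : ℝ)
    (v : H) :
    (s * t / (2 * Real.pi * Real.exp 1 * c) * ‖v‖ ^ 2) ^ 2 ≤
      (∑ x, ‖inner ℂ (e x) v‖ ^ 2 * (a - ξ x) ^ 2 + ‖v‖ ^ 2 * (s ^ 2 / 12)) *
      (∑ z, ‖inner ℂ (g z) v‖ ^ 2 * (b - ζ z) ^ 2 + ‖v‖ ^ 2 * (t ^ 2 / 12)) := by
  rcases eq_or_ne v 0 with rfl | hv0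
  · simp
  have hr : 0 < ‖v‖ := norm_pos_iff.2 hv0
  have h := sq_le_msd_mul_msd_of_norm_eq_one e g hc hU hs ht hξ hζ a b
    (v := ((‖v‖⁻¹ : ℝ) : ℂ) • v) (by
      rw [norm_smul, Complex.norm_real, norm_inv, norm_norm, inv_mul_cancel₀ hr.ne'])
  have hsc : ∀ (o : OrthonormalBasis ι ℂ H) (k : ℝ) (η : ι → ℝ) (r : ℝ),
      ∑ x, ‖inner ℂ (o x) (((‖v‖⁻¹ : ℝ) : ℂ) • v)‖ ^ 2 * (k - η x) ^ 2 + r =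
        (‖v‖⁻¹) ^ 2 * (∑ x, ‖inner ℂ (o x) v‖ ^ 2 * (k - η x) ^ 2 + ‖v‖ ^ 2 * r) := by
    intro o k η r
    rw [mul_add, Finset.mul_sum, ← mul_assoc, ← mul_pow, inv_mul_cancel₀ hr.ne', one_pow, one_mul]
    congr 1
    refine Finset.sum_congr rfl fun x _ => ?_
    rw [inner_smul_right, norm_mul, Complex.norm_real, norm_inv, norm_norm]
    ring
  rw [hsc, hsc] at h
  rw [mul_pow]
  calc _ ≤ _ := mul_le_mul_of_nonneg_right h (sq_nonneg (‖v‖ ^ 2))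
    _ = _ := by field_simp

end StateTradeoff

section Kraus

lemma sum_normSq_eq_dotProduct {n : ℕ} (y : Fin n → ℂ) :
    ((∑ i, Complex.normSq (y i) : ℝ) : ℂ) = star y ⬝ᵥ y := by
  simp [dotProduct, Complex.normSq_eq_conj_mul_self]

/-- A complete family of Kraus operators preserves the total squared norm. -/
lemma sum_sum_normSq_mulVec {n k : ℕ} {κ : Type*} [Fintype κ]
    (K : κ → Matrix (Fin k) (Fin n) ℂ) (hK : ∑ j, (K j)ᴴ * K j = 1) (y : Fin n → ℂ) :
    ∑ j, ∑ i, Complex.normSq ((K j).mulVec y i) = ∑ i, Complex.normSq (y i) := by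
  apply Complex.ofReal_injective
  rw [sum_normSq_eq_dotProduct, Complex.ofReal_sum]
  simp_rw [sum_normSq_eq_dotProduct, Matrix.star_mulVec, ← Matrix.dotProduct_mulVec,
    Matrix.mulVec_mulVec]
  rw [← dotProduct_sum, ← Matrix.sum_mulVec, hK, Matrix.one_mulVec]

lemma inner_toLp_eq_dotc {n : ℕ} (u v : Fin n → ℂ) :
    inner ℂ (WithLp.toLp 2 u) (WithLp.toLp 2 v) = dotc u v := by
  rw [EuclideanSpace.inner_toLp_toLp, dotc, dotProduct]
  exact Finset.sum_congr rfl fun i _ => mul_comm _ _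

lemma norm_dotc_conjTranspose_mulVec {n k : ℕ} (A : Matrix (Fin k) (Fin n) ℂ) (u : Fin k → ℂ)
    (y : Fin n → ℂ) : ‖dotc y (Aᴴ.mulVec u)‖ ^ 2 = Complex.normSq (dotc u (A.mulVec y)) := by
  have hdot : ∀ {m : ℕ} (u v : Fin m → ℂ), dotc u v = star u ⬝ᵥ v := fun u v => rfl
  rw [← Complex.normSq_eq_norm_sq, hdot, hdot, Matrix.dotProduct_mulVec, ← Matrix.star_mulVec,
    ← Complex.normSq_conj, starRingEnd_apply, ← Matrix.star_dotProduct]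

/-- An orthonormal family for `dotc`, as an orthonormal basis of Euclidean space. -/
lemma exists_orthonormalBasis_of_dotc {d : ℕ} (ψ : Fin d → Fin d → ℂ)
    (hψ : ∀ x x', dotc (ψ x) (ψ x') = if x = x' then 1 else 0) :
    ∃ e : OrthonormalBasis (Fin d) ℂ (EuclideanSpace ℂ (Fin d)),
      ∀ x, e x = WithLp.toLp 2 (ψ x) := by
  have ho : Orthonormal ℂ fun x => (WithLp.toLp 2 (ψ x) : EuclideanSpace ℂ (Fin d)) := by
    rw [orthonormal_iff_ite]
    intro x x'
    rw [inner_toLp_eq_dotc, hψ]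
  have hspan := ho.linearIndependent.span_eq_top_of_card_eq_finrank' (by simp)
  exact ⟨OrthonormalBasis.mk ho hspan.ge, fun x => by simp⟩

lemma sum_normSq_dotc {d : ℕ} (ψ : Fin d → Fin d → ℂ)
    (hψ : ∀ x x', dotc (ψ x) (ψ x') = if x = x' then 1 else 0) (y : Fin d → ℂ) :
    ∑ x, Complex.normSq (dotc (ψ x) y) = ∑ i, Complex.normSq (y i) := by
  obtain ⟨e, he⟩ := exists_orthonormalBasis_of_dotc ψ hψ
  have h := e.sum_sq_norm_inner_right (WithLp.toLp 2 y)
  simp_rw [he, inner_toLp_eq_dotc, EuclideanSpace.norm_sq_eq, ← Complex.normSq_eq_norm_sq] at h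
  exact h

lemma le_abs_sub_of_lattice {ι : Type*} {ξ : ι → ℝ} (hξ : Function.Injective ξ) {s : ℝ}
    (hs : 0 < s) (hlat : ∀ x x', ∃ k : ℤ, ξ x - ξ x' = k * s) (x y : ι) (hxy : x ≠ y) :
    s ≤ |ξ x - ξ y| := by
  obtain ⟨k, hk⟩ := hlat x y
  have hk0 : k ≠ 0 := by
    rintro rfl
    exact hxy (hξ (sub_eq_zero.1 (by simpa using hk)))
  rw [hk, abs_mul, abs_of_pos hs]
  exact le_mul_of_one_le_left hs.le (by exact_mod_cast Int.one_le_abs hk0)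

end Kraus

/-- **Mean-square-deviation noise–disturbance tradeoff (Eq. (6)).**
For any instrument `K`, correction `E`, estimator `f`, and lattice-valued eigenvalue
assignments `ξ`, `ζ` with spacings `s_X`, `s_Z`,
`(V_N + s_X²/12)(V_D + s_Z²/12) ≥ (s_X s_Z / (2πe c))²`. -/
theorem msd_noise_disturbance_tradeoff
    {d d' : ℕ} (hd : 0 < d)
    {M J L : Type*} [Fintype M] [Fintype J] [Fintype L]
    (ψ φ : Fin d → (Fin d → ℂ))
    (hψ : ∀ x x', dotc (ψ x) (ψ x') = if x = x' then 1 else 0)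
    (hφ : ∀ z z', dotc (φ z) (φ z') = if z = z' then 1 else 0)
    (K : M → J → Matrix (Fin d') (Fin d) ℂ)
    (hK : ∑ m, ∑ j, (K m j)ᴴ * K m j = 1)
    (E : M → L → Matrix (Fin d) (Fin d') ℂ)
    (hE : ∀ m, ∑ l, (E m l)ᴴ * E m l = 1)
    (ξ ζ : Fin d → ℝ) (hξinj : Function.Injective ξ) (hζinj : Function.Injective ζ)
    (sX sZ : ℝ) (hsX : 0 < sX) (hsZ : 0 < sZ)
    (hξlat : ∀ x x', ∃ k : ℤ, ξ x - ξ x' = k * sX)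
    (hζlat : ∀ z z', ∃ k : ℤ, ζ z - ζ z' = k * sZ)
    (f : M → ℝ) :
    ((∑ m, ∑ x, ((1 / (d : ℝ)) * ∑ j, ∑ i,
          Complex.normSq ((K m j).mulVec (ψ x) i)) * (f m - ξ x) ^ 2)
        + sX ^ 2 / 12)
      * ((∑ zh, ∑ z, ((1 / (d : ℝ)) * ∑ m, ∑ j, ∑ l,
          Complex.normSq (dotc (φ zh) ((E m l).mulVec ((K m j).mulVec (φ z)))))
            * (ζ zh - ζ z) ^ 2)
        + sZ ^ 2 / 12)
      ≥ (sX * sZ / (2 * Real.pi * Real.exp 1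
          * (⨆ xz : Fin d × Fin d, Complex.normSq (dotc (ψ xz.1) (φ xz.2))))) ^ 2 := by
  have hd0 : (0 : ℝ) < d := by exact_mod_cast hd
  set c := ⨆ xz : Fin d × Fin d, Complex.normSq (dotc (ψ xz.1) (φ xz.2)) with hcdef
  have hc0 : 0 ≤ c := Real.iSup_nonneg fun _ => Complex.normSq_nonneg _
  obtain ⟨e, he⟩ := exists_orthonormalBasis_of_dotc ψ hψ
  obtain ⟨g, hg⟩ := exists_orthonormalBasis_of_dotc φ hφ
  let v : M × J × L × Fin d → EuclideanSpace ℂ (Fin d) := fun p =>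
    WithLp.toLp 2 ((E p.1 p.2.2.1 * K p.1 p.2.1)ᴴ.mulVec (φ p.2.2.2))
  have hev : ∀ x p, ‖inner ℂ (e x) (v p)‖ ^ 2 = Complex.normSq
      (dotc (φ p.2.2.2) ((E p.1 p.2.2.1).mulVec ((K p.1 p.2.1).mulVec (ψ x)))) := by
    intro x p
    rw [he, inner_toLp_eq_dotc, norm_dotc_conjTranspose_mulVec, Matrix.mulVec_mulVec]
  have hgv : ∀ x p, ‖inner ℂ (g x) (v p)‖ ^ 2 = Complex.normSq
      (dotc (φ p.2.2.2) ((E p.1 p.2.2.1).mulVec ((K p.1 p.2.1).mulVec (φ x)))) := by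
    intro x p
    rw [hg, inner_toLp_eq_dotc, norm_dotc_conjTranspose_mulVec, Matrix.mulVec_mulVec]
  have hout : ∀ m (y : Fin d' → ℂ), ∑ l, ∑ zh, Complex.normSq (dotc (φ zh) ((E m l).mulVec y)) =
      ∑ i, Complex.normSq (y i) := by
    intro m y
    simp_rw [sum_normSq_dotc φ hφ]
    exact sum_sum_normSq_mulVec _ (hE m) y
  have hin : ∀ y : Fin d → ℂ, ∑ m, ∑ j, ∑ i, Complex.normSq ((K m j).mulVec y i) =
      ∑ i, Complex.normSq (y i) := by
    intro y
    rw [← sum_sum_normSq_mulVec (fun p : M × J => K p.1 p.2)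
      (by rw [Fintype.sum_prod_type, hK]) y, Fintype.sum_prod_type]
  have hnorm : ∑ p, ‖v p‖ ^ 2 = d := by
    simp_rw [← e.sum_sq_norm_inner_right (v _), hev]
    rw [Finset.sum_comm]
    simp_rw [Fintype.sum_prod_type, hout, hin, ← sum_normSq_dotc ψ hψ (ψ _), hψ]
    simp [apply_ite Complex.normSq]
  have hVN : ∑ p, ∑ x, ‖inner ℂ (e x) (v p)‖ ^ 2 * (f p.1 - ξ x) ^ 2 =
      d * ∑ m, ∑ x, ((1 / (d : ℝ)) * ∑ j, ∑ i,
        Complex.normSq ((K m j).mulVec (ψ x) i)) * (f m - ξ x) ^ 2 := by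
    rw [Finset.sum_comm, Finset.sum_comm (s := (Finset.univ : Finset M)), Finset.mul_sum]
    refine Finset.sum_congr rfl fun x _ => ?_
    simp_rw [hev, Fintype.sum_prod_type, ← Finset.sum_mul, hout]
    rw [Finset.mul_sum]
    refine Finset.sum_congr rfl fun m _ => ?_
    field_simp
  have hVD : ∑ p, ∑ z, ‖inner ℂ (g z) (v p)‖ ^ 2 * (ζ p.2.2.2 - ζ z) ^ 2 =
      d * ∑ zh, ∑ z, ((1 / (d : ℝ)) * ∑ m, ∑ j, ∑ l,
        Complex.normSq (dotc (φ zh) ((E m l).mulVec ((K m j).mulVec (φ z)))))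
          * (ζ zh - ζ z) ^ 2 := by
    rw [Finset.sum_comm, Finset.sum_comm (s := (Finset.univ : Finset (Fin d)))
      (t := (Finset.univ : Finset (Fin d))), Finset.mul_sum]
    refine Finset.sum_congr rfl fun z _ => ?_
    simp_rw [hgv, Fintype.sum_prod_type]
    rw [Finset.mul_sum]
    have hcomm : ∀ F : M → J → L → Fin d → ℝ, ∑ m, ∑ j, ∑ l, ∑ zh, F m j l zh =
        ∑ zh, ∑ m, ∑ j, ∑ l, F m j l zh := by
      intro F
      rw [Finset.sum_comm (s := (Finset.univ : Finset (Fin d)))]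
      refine Finset.sum_congr rfl fun m _ => ?_
      rw [Finset.sum_comm (s := (Finset.univ : Finset (Fin d)))]
      refine Finset.sum_congr rfl fun j _ => ?_
      rw [Finset.sum_comm]
    rw [hcomm]
    refine Finset.sum_congr rfl fun zh _ => ?_
    simp_rw [← Finset.sum_mul]
    field_simp
  rw [ge_iff_le]
  rcases hc0.eq_or_lt with hc | hc
  · rw [← hc]
    simp only [mul_zero, div_zero, ne_eq, OfNat.ofNat_ne_zero, not_false_eq_true, zero_pow]
    have hnn := Complex.normSq_nonneg
    refine mul_nonneg (add_nonneg (Finset.sum_nonneg fun _ _ => Finset.sum_nonneg fun _ _ => ?_)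
      (by positivity)) (add_nonneg (Finset.sum_nonneg fun _ _ => Finset.sum_nonneg fun _ _ => ?_)
      (by positivity))
    · exact mul_nonneg (mul_nonneg (by positivity) (Finset.sum_nonneg fun _ _ =>
        Finset.sum_nonneg fun _ _ => hnn _)) (sq_nonneg _)
    · exact mul_nonneg (mul_nonneg (by positivity) (Finset.sum_nonneg fun _ _ =>
        Finset.sum_nonneg fun _ _ => Finset.sum_nonneg fun _ _ => hnn _)) (sq_nonneg _)
  have hU : ∀ x z, ‖inner ℂ (e x) (g z)‖ ^ 2 ≤ c := by
    intro x z
    rw [he, hg, inner_toLp_eq_dotc, ← Complex.normSq_eq_norm_sq]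
    exact le_ciSup (f := fun xz : Fin d × Fin d => Complex.normSq (dotc (ψ xz.1) (φ xz.2)))
      (Set.finite_range _).bddAbove (x, z)
  have hCS := Finset.sum_sq_le_sum_mul_sum_of_sq_le_mul (Finset.univ : Finset (M × J × L × Fin d))
    (fun p _ => by positivity) (fun p _ => by positivity)
    (fun p _ => sq_le_msd_mul_msd e g hc hU hsX hsZ (le_abs_sub_of_lattice hξinj hsX hξlat)
      (le_abs_sub_of_lattice hζinj hsZ hζlat) (f p.1) (ζ p.2.2.2) (v p))
  rw [← Finset.mul_sum, Finset.sum_add_distrib, Finset.sum_add_distrib, ← Finset.sum_mul,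
    ← Finset.sum_mul, hnorm, hVN, hVD, ← mul_add, ← mul_add, mul_pow] at hCS
  refine le_of_mul_le_mul_right (hCS.trans_eq ?_) (pow_pos hd0 2)
  ring
end

section
/- Qubit Pauli MSD tradeoff (Eq. (S.11)). Let {ψ^0, ψ^1} and {φ^0, φ^1} be orthonormal bases of ℂ² that are mutually unbiased, i.e. |⟨ψ^x, φ^z⟩|² = 1/2 for all x, z ∈ Fin 2, with eigenvalue assignments ξ(0) = ζ(0) = 1 and ξ(1) = ζ(1) = −1. Let a quantum instrument be given by Kraus operators K(m,j) and a correction operation by Kraus operators E(m,l); define p_N(m,x) := (1/2) ∑_{j∈J} ‖K(m,j) ψ^x‖² and p_D(ẑ,z) := (1/2) ∑_{m,j,l} |⟨φ^{ẑ}, E(m,l) K(m,j) φ^z⟩|². Then for every estimator f : M → ℝ, setting V_N := ∑_{m,x} p_N(m,x)(f(m) − ξ(x))² and V_D := ∑_{ẑ,z} p_D(ẑ,z)(ζ(ẑ) − ζ(z))², one has (V_N + 1/3)·(V_D + 1/3) ≥ 16/(π² e²). -/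
open scoped BigOperators Matrix

/-- Pauli eigenvalue assignment on a qubit: `+1` for outcome `0` and `−1` for outcome `1`. -/
noncomputable def pauliVal (x : Fin 2) : ℝ := if x = 0 then 1 else -1

/-- Completeness relation of an orthonormal basis of `ℂ²`. -/
theorem sum_mul_conj_of_orthonormal {φ : Fin 2 → Fin 2 → ℂ}
    (hφ : ∀ z z', dotc (φ z) (φ z') = if z = z' then 1 else 0) (i k : Fin 2) :
    ∑ z, φ z i * (starRingEnd ℂ) (φ z k) = if i = k then 1 else 0 := by
  have h : (Matrix.of fun i z => φ z i)ᴴ * (Matrix.of fun i z => φ z i) = 1 := by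
    ext z z'
    simpa [Matrix.mul_apply, Matrix.one_apply, dotc] using hφ z z'
  have h' := congrArg (fun A => A i k) (mul_eq_one_comm.mp h)
  simpa [Matrix.mul_apply, Matrix.one_apply] using h'

theorem sum_dotc_smul_of_orthonormal {φ : Fin 2 → Fin 2 → ℂ}
    (hφ : ∀ z z', dotc (φ z) (φ z') = if z = z' then 1 else 0) (v : Fin 2 → ℂ) :
    v = dotc (φ 0) v • φ 0 + dotc (φ 1) v • φ 1 := by
  ext i
  have h0 := sum_mul_conj_of_orthonormal hφ i 0
  have h1 := sum_mul_conj_of_orthonormal hφ i 1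
  simp only [Fin.sum_univ_two] at h0 h1
  simp only [dotc, Fin.sum_univ_two, Pi.add_apply, Pi.smul_apply, smul_eq_mul]
  have h : v i = (if i = 0 then 1 else 0) * v 0 + (if i = 1 then 1 else 0) * v 1 := by
    fin_cases i <;> simp
  rw [h, ← h0, ← h1]
  ring

theorem sum_normSq_eq_dotc {n : ℕ} (v : Fin n → ℂ) :
    ((∑ i, Complex.normSq (v i) : ℝ) : ℂ) = dotc v v := by
  simp [dotc, Complex.normSq_eq_conj_mul_self]

/-- Parseval's identity on `ℂ²`. -/
theorem sum_normSq_eq_sum_normSq_dotc {φ : Fin 2 → Fin 2 → ℂ}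
    (hφ : ∀ z z', dotc (φ z) (φ z') = if z = z' then 1 else 0) (v : Fin 2 → ℂ) :
    ∑ i, Complex.normSq (v i) = ∑ z, Complex.normSq (dotc (φ z) v) := by
  rw [← Complex.ofReal_inj, sum_normSq_eq_dotc]
  have h00 := sum_mul_conj_of_orthonormal hφ 0 0
  have h01 := sum_mul_conj_of_orthonormal hφ 0 1
  have h10 := sum_mul_conj_of_orthonormal hφ 1 0
  have h11 := sum_mul_conj_of_orthonormal hφ 1 1
  simp only [Fin.sum_univ_two, Fin.isValue, zero_ne_one, one_ne_zero, if_true, if_false] at *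
  simp only [Complex.ofReal_add, Complex.normSq_eq_conj_mul_self, dotc, Fin.sum_univ_two, map_add,
    map_mul, Complex.conj_conj]
  linear_combination -(starRingEnd ℂ) (v 0) * v 0 * h00 - (starRingEnd ℂ) (v 0) * v 1 * h01
    - (starRingEnd ℂ) (v 1) * v 0 * h10 - (starRingEnd ℂ) (v 1) * v 1 * h11

theorem dotc_eq_star_dotProduct {n : ℕ} (u v : Fin n → ℂ) : dotc u v = star u ⬝ᵥ v := rfl

theorem dotc_mulVec_mulVec {m n : ℕ} (A : Matrix (Fin m) (Fin n) ℂ) (u : Fin n → ℂ) :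
    dotc (A.mulVec u) (A.mulVec u) = star u ⬝ᵥ (Aᴴ * A).mulVec u := by
  rw [dotc_eq_star_dotProduct, Matrix.star_mulVec, Matrix.dotProduct_mulVec,
    Matrix.vecMul_vecMul, Matrix.dotProduct_mulVec]

/-- The Kraus operators of a channel preserve the squared norm in total. -/
theorem sum_sum_normSq_mulVec_s10 {m n : ℕ} {L : Type*} [Fintype L]
    (E : L → Matrix (Fin m) (Fin n) ℂ) (hE : ∑ l, (E l)ᴴ * E l = 1) (u : Fin n → ℂ) :
    ∑ l, ∑ i, Complex.normSq ((E l).mulVec u i) = ∑ i, Complex.normSq (u i) := by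
  rw [← Complex.ofReal_inj, Complex.ofReal_sum, sum_normSq_eq_dotc]
  simp only [sum_normSq_eq_dotc, dotc_mulVec_mulVec]
  rw [← dotProduct_sum, ← Matrix.sum_mulVec, hE, Matrix.one_mulVec,
    dotc_eq_star_dotProduct]

/-- The sum of `‖B ψ x‖²` over an orthonormal basis is the squared Frobenius norm of `B`. -/
theorem sum_sum_normSq_mulVec_of_orthonormal {n : ℕ} {ψ : Fin 2 → Fin 2 → ℂ}
    (hψ : ∀ x x', dotc (ψ x) (ψ x') = if x = x' then 1 else 0) (B : Matrix (Fin n) (Fin 2) ℂ) :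
    ∑ x, ∑ i, Complex.normSq (B.mulVec (ψ x) i) = ∑ i, ∑ k, Complex.normSq (B i k) := by
  rw [Finset.sum_comm]
  refine Finset.sum_congr rfl fun i _ => ?_
  have h := sum_normSq_eq_sum_normSq_dotc hψ (fun k => (starRingEnd ℂ) (B i k))
  simp only [Complex.normSq_conj] at h
  rw [h]
  refine Finset.sum_congr rfl fun x _ => ?_
  rw [← Complex.normSq_conj]
  simp [Matrix.mulVec, dotProduct, dotc, mul_comm]

theorem scalar_msd_bound (c₀ c₁ a₀ a₁ b₀ b₁ : ℂ) (hc₀ : Complex.normSq c₀ = 1 / 2)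
    (hc₁ : Complex.normSq c₁ = 1 / 2) (f p q : ℝ)
    (hp : p = Complex.normSq (c₀ * a₀ + c₁ * b₀) + Complex.normSq (c₀ * a₁ + c₁ * b₁))
    (hpq : p + q = Complex.normSq a₀ + Complex.normSq a₁
      + (Complex.normSq b₀ + Complex.normSq b₁)) :
    p + q ≤ p * (f - 1) ^ 2 + q * (f + 1) ^ 2
      + 4 * (Complex.normSq a₁ + Complex.normSq b₀) := by
  obtain rfl : q = Complex.normSq a₀ + Complex.normSq a₁
      + (Complex.normSq b₀ + Complex.normSq b₁) - p := by linarith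
  have h₀ := Complex.normSq_nonneg ((f : ℂ) * (c₀ * a₀) - (2 : ℝ) * (c₁ * b₀))
  have h₁ := Complex.normSq_nonneg ((2 : ℝ) * (c₀ * a₁) - (f : ℂ) * (c₁ * b₁))
  have e₀ : ((f : ℂ) * (c₀ * a₀) * (starRingEnd ℂ) ((2 : ℝ) * (c₁ * b₀))).re
      = 2 * f * (c₀ * a₀ * (starRingEnd ℂ) (c₁ * b₀)).re := by
    simp only [map_mul, Complex.conj_ofReal, Complex.mul_re, Complex.mul_im, Complex.ofReal_re,
      Complex.ofReal_im]
    ring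
  have e₁ : ((2 : ℝ) * (c₀ * a₁) * (starRingEnd ℂ) ((f : ℂ) * (c₁ * b₁))).re
      = 2 * f * (c₀ * a₁ * (starRingEnd ℂ) (c₁ * b₁)).re := by
    simp only [map_mul, Complex.conj_ofReal, Complex.mul_re, Complex.mul_im, Complex.ofReal_re,
      Complex.ofReal_im]
    ring
  rw [Complex.normSq_sub, e₀] at h₀
  rw [Complex.normSq_sub, e₁] at h₁
  rw [Complex.normSq_add, Complex.normSq_add] at hp
  simp only [Complex.normSq_mul, Complex.normSq_ofReal, hc₀, hc₁] at h₀ h₁ hp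
  subst hp
  have hb := mul_nonneg (sq_nonneg f) (Complex.normSq_nonneg b₀)
  have ha := mul_nonneg (sq_nonneg f) (Complex.normSq_nonneg a₁)
  linarith

/-- Error–disturbance bound for a single Kraus operator on a qubit. -/
theorem kraus_msd_bound {ψ φ : Fin 2 → Fin 2 → ℂ}
    (hψ : ∀ x x', dotc (ψ x) (ψ x') = if x = x' then 1 else 0)
    (hφ : ∀ z z', dotc (φ z) (φ z') = if z = z' then 1 else 0)
    (hmub : ∀ x z, Complex.normSq (dotc (ψ x) (φ z)) = 1 / 2)
    (B : Matrix (Fin 2) (Fin 2) ℂ) (f : ℝ) :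
    ∑ x, ∑ i, Complex.normSq (B.mulVec (ψ x) i)
      ≤ ∑ x, (∑ i, Complex.normSq (B.mulVec (ψ x) i)) * (f - pauliVal x) ^ 2
        + ∑ zh, ∑ z, Complex.normSq (dotc (φ zh) (B.mulVec (φ z)))
          * (pauliVal zh - pauliVal z) ^ 2 := by
  have hconj : ∀ u v : Fin 2 → ℂ, Complex.normSq (dotc u v) = Complex.normSq (dotc v u) := by
    intro u v
    rw [← Complex.normSq_conj]
    simp [dotc, mul_comm]
  have hlin : ∀ z, dotc (φ z) (B.mulVec (ψ 0))
      = dotc (φ 0) (ψ 0) * dotc (φ z) (B.mulVec (φ 0))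
        + dotc (φ 1) (ψ 0) * dotc (φ z) (B.mulVec (φ 1)) := by
    intro z
    conv_lhs => rw [sum_dotc_smul_of_orthonormal hφ (ψ 0)]
    simp only [Matrix.mulVec_add, Matrix.mulVec_smul, dotc_eq_star_dotProduct, dotProduct_add,
      dotProduct_smul, smul_eq_mul]
  have hp : ∑ i, Complex.normSq (B.mulVec (ψ 0) i) = _ :=
    sum_normSq_eq_sum_normSq_dotc hφ (B.mulVec (ψ 0))
  have hpq := (sum_sum_normSq_mulVec_of_orthonormal hψ B).trans
    (sum_sum_normSq_mulVec_of_orthonormal hφ B).symm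
  simp only [sum_normSq_eq_sum_normSq_dotc hφ (B.mulVec (φ _))] at hpq
  simp only [Fin.sum_univ_two] at hp hpq ⊢
  rw [hlin, hlin] at hp
  have key := scalar_msd_bound _ _ _ _ _ _ ((hconj _ _).trans (hmub 0 0))
    ((hconj _ _).trans (hmub 0 1)) f _ _ hp hpq
  simp only [pauliVal, if_true, one_ne_zero, if_false]
  linarith

/-- The mean square deviations of noise and disturbance of a qubit instrument add up to at
least `1`. -/
theorem one_le_noise_add_disturbance
    {d' : ℕ} {M J L : Type*} [Fintype M] [Fintype J] [Fintype L]
    {ψ φ : Fin 2 → (Fin 2 → ℂ)}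
    (hψ : ∀ x x', dotc (ψ x) (ψ x') = if x = x' then 1 else 0)
    (hφ : ∀ z z', dotc (φ z) (φ z') = if z = z' then 1 else 0)
    (hmub : ∀ x z, Complex.normSq (dotc (ψ x) (φ z)) = 1 / 2)
    (K : M → J → Matrix (Fin d') (Fin 2) ℂ)
    (hK : ∑ m, ∑ j, (K m j)ᴴ * K m j = 1)
    (E : M → L → Matrix (Fin 2) (Fin d') ℂ)
    (hE : ∀ m, ∑ l, (E m l)ᴴ * E m l = 1)
    (f : M → ℝ) :
    1 ≤ (∑ m, ∑ x, ((1 / 2 : ℝ) * ∑ j, ∑ i,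
          Complex.normSq ((K m j).mulVec (ψ x) i)) * (f m - pauliVal x) ^ 2)
      + ∑ zh, ∑ z, ((1 / 2 : ℝ) * ∑ m, ∑ j, ∑ l,
          Complex.normSq (dotc (φ zh) ((E m l).mulVec ((K m j).mulVec (φ z)))))
            * (pauliVal zh - pauliVal z) ^ 2 := by
  have hnorm : ∑ x, ∑ m, ∑ j, ∑ i, Complex.normSq ((K m j).mulVec (ψ x) i) = 2 := by
    have hx : ∀ x, ∑ m, ∑ j, ∑ i, Complex.normSq ((K m j).mulVec (ψ x) i) = 1 := by
      intro x
      have h := sum_sum_normSq_mulVec_s10 (fun s : M × J => K s.1 s.2)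
        (by rw [Fintype.sum_prod_type]; exact hK) (ψ x)
      rw [Fintype.sum_prod_type] at h
      rw [h, ← Complex.ofReal_inj, sum_normSq_eq_dotc, hψ]
      simp
    rw [Fin.sum_univ_two, hx, hx]
    norm_num
  have hmj : ∀ m j, ∑ x, ∑ i, Complex.normSq ((K m j).mulVec (ψ x) i)
      ≤ ∑ x, (∑ i, Complex.normSq ((K m j).mulVec (ψ x) i)) * (f m - pauliVal x) ^ 2
        + ∑ zh, ∑ z, (∑ l, Complex.normSq (dotc (φ zh) ((E m l).mulVec ((K m j).mulVec (φ z)))))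
          * (pauliVal zh - pauliVal z) ^ 2 := by
    intro m j
    have h := Finset.sum_le_sum fun l (_ : l ∈ Finset.univ) =>
      kraus_msd_bound hψ hφ hmub (E m l * K m j) (f m)
    simp only [← Matrix.mulVec_mulVec, Finset.sum_add_distrib] at h
    have hE' := fun x => sum_sum_normSq_mulVec_s10 (E m) (hE m) ((K m j).mulVec (ψ x))
    simp only [← hE']
    simp only [Fin.sum_univ_two, Finset.sum_add_distrib,
      ← Finset.sum_mul] at h ⊢
    exact h
  have h := Finset.sum_le_sum fun m (_ : m ∈ Finset.univ) =>
    Finset.sum_le_sum fun j (_ : j ∈ Finset.univ) => hmj m j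
  simp only [Fin.sum_univ_two, Finset.sum_add_distrib, ← Finset.sum_mul] at h hnorm ⊢
  simp only [mul_assoc (1 / 2 : ℝ), ← Finset.mul_sum]
  linarith

/-- **Qubit Pauli MSD tradeoff (Eq. (S.11)).**
For mutually unbiased qubit bases with eigenvalues `±1`, any instrument, correction and
estimator satisfy `(V_N + 1/3)(V_D + 1/3) ≥ 16/(π²e²)`. -/
theorem qubit_msd_tradeoff
    {d' : ℕ} {M J L : Type*} [Fintype M] [Fintype J] [Fintype L]
    (ψ φ : Fin 2 → (Fin 2 → ℂ))
    (hψ : ∀ x x', dotc (ψ x) (ψ x') = if x = x' then 1 else 0)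
    (hφ : ∀ z z', dotc (φ z) (φ z') = if z = z' then 1 else 0)
    (hmub : ∀ x z, Complex.normSq (dotc (ψ x) (φ z)) = 1 / 2)
    (K : M → J → Matrix (Fin d') (Fin 2) ℂ)
    (hK : ∑ m, ∑ j, (K m j)ᴴ * K m j = 1)
    (E : M → L → Matrix (Fin 2) (Fin d') ℂ)
    (hE : ∀ m, ∑ l, (E m l)ᴴ * E m l = 1)
    (f : M → ℝ) :
    ((∑ m, ∑ x, ((1 / 2 : ℝ) * ∑ j, ∑ i,
          Complex.normSq ((K m j).mulVec (ψ x) i)) * (f m - pauliVal x) ^ 2) + 1 / 3)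
      * ((∑ zh, ∑ z, ((1 / 2 : ℝ) * ∑ m, ∑ j, ∑ l,
          Complex.normSq (dotc (φ zh) ((E m l).mulVec ((K m j).mulVec (φ z)))))
            * (pauliVal zh - pauliVal z) ^ 2) + 1 / 3)
      ≥ 16 / (Real.pi ^ 2 * Real.exp 1 ^ 2) := by
  have hsum := one_le_noise_add_disturbance hψ hφ hmub K hK E hE f
  set N := ∑ m, ∑ x, ((1 / 2 : ℝ) * ∑ j, ∑ i,
    Complex.normSq ((K m j).mulVec (ψ x) i)) * (f m - pauliVal x) ^ 2
  set D := ∑ zh, ∑ z, ((1 / 2 : ℝ) * ∑ m, ∑ j, ∑ l,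
    Complex.normSq (dotc (φ zh) ((E m l).mulVec ((K m j).mulVec (φ z)))))
      * (pauliVal zh - pauliVal z) ^ 2
  have hN0 : 0 ≤ N := Finset.sum_nonneg fun m _ => Finset.sum_nonneg fun x _ =>
    mul_nonneg (mul_nonneg (by norm_num) (Finset.sum_nonneg fun j _ =>
      Finset.sum_nonneg fun i _ => Complex.normSq_nonneg _)) (sq_nonneg _)
  have hD0 : 0 ≤ D := Finset.sum_nonneg fun zh _ => Finset.sum_nonneg fun z _ =>
    mul_nonneg (mul_nonneg (by norm_num) (Finset.sum_nonneg fun m _ => Finset.sum_nonneg fun j _ =>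
      Finset.sum_nonneg fun l _ => Complex.normSq_nonneg _)) (sq_nonneg _)
  have hπe : 6 ≤ Real.pi * Real.exp 1 := by
    have h2 := Real.add_one_le_exp 1
    nlinarith [Real.pi_gt_three]
  have hc : 16 / (Real.pi ^ 2 * Real.exp 1 ^ 2) ≤ 4 / 9 := by
    rw [div_le_iff₀ (by positivity), ← mul_pow]
    nlinarith
  have hND := mul_nonneg hN0 hD0
  linarith
end
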